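/- arXiv:1004.2685 — 9 statements merged into one kernel-verified Lean document; each statement's English description precedes it below -/
import Mathlib

section
/- If τ : ℙ → ℙ is a strictly increasing map and κ is a k-balanced coloring of a finite simple graph G, then τ∘κ is a k-balanced coloring of G inducing the same orientation. Consequently, for any composition α = (α_1, …, α_ℓ) and any two increasing sequences of colors i_1 < i_2 < ⋯ < i_ℓ and j_1 < j_2 < ⋯ < j_ℓ, the number of k-balanced colorings of G whose set of used colors is {i_1, …, i_ℓ} with exactly α_t vertices colored i_t for each t equals the number of k-balanced colorings whose set of used colors is {j_1, …, j_ℓ} with exactly α_t vertices colored j_t for each t (i.e., the generating function X_G^k is quasisymmetric). -/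
open Classical in
/-- Number of darts of a closed walk `c` that are oriented "forward" by the relation `r`. -/
noncomputable def fwdCount {V : Type*} {G : SimpleGraph V} {v : V}
    (r : V → V → Prop) (c : G.Walk v v) : ℕ :=
  (c.darts.filter fun d => decide (r d.toProd.1 d.toProd.2)).length

/-- A relation `r` (directing some of the edges of `G`) is `k`-balanced if along every
cycle of `G` at least `k` edges are directed forward by `r` and at least `k` backward. -/
def KBalancedRel {V : Type*} (G : SimpleGraph V) (r : V → V → Prop) (k : ℕ) : Prop :=
  ∀ ⦃v : V⦄ (c : G.Walk v v), c.IsCycle →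
    k ≤ fwdCount r c ∧ k ≤ fwdCount (fun i j => r j i) c

/-- An orientation of a simple graph `G`: for every edge `{i,j}` exactly one of
`(i,j)`, `(j,i)` is a directed edge. -/
structure GraphOrientation {V : Type*} (G : SimpleGraph V) where
  dir : V → V → Prop
  dir_adj : ∀ ⦃i j⦄, dir i j → G.Adj i j
  exactlyOne : ∀ ⦃i j⦄, G.Adj i j → (dir i j ↔ ¬ dir j i)

/-- A `k`-balanced orientation. -/
def GraphOrientation.KBalanced {V : Type*} {G : SimpleGraph V} (O : GraphOrientation G)
    (k : ℕ) : Prop :=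
  KBalancedRel G O.dir k

/-- An acyclic orientation: no directed cycles. -/
def GraphOrientation.Acyclic {V : Type*} {G : SimpleGraph V} (O : GraphOrientation G) : Prop :=
  Irreflexive (Relation.TransGen O.dir)

/-- A proper coloring of `G` by positive integers. -/
def IsProperColoring {V : Type*} (G : SimpleGraph V) (κ : V → ℕ+) : Prop :=
  ∀ ⦃i j⦄, G.Adj i j → κ i ≠ κ j

/-- A `k`-balanced coloring: a proper coloring whose induced orientation (each edge directed
towards the larger color) is `k`-balanced. -/
def IsKBalancedColoring {V : Type*} (G : SimpleGraph V) (k : ℕ) (κ : V → ℕ+) : Prop :=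
  IsProperColoring G κ ∧ KBalancedRel G (fun i j => κ i < κ j) k

/-- `χ_G^k(λ)`: the number of `k`-balanced colorings of `G` using colors from `{1,…,λ}`. -/
noncomputable def kChromCount {V : Type*} [Fintype V] (G : SimpleGraph V) (k : ℕ)
    (lam : ℕ) : ℕ :=
  Nat.card {κ : V → ℕ+ // IsKBalancedColoring G k κ ∧ ∀ v, (κ v : ℕ) ≤ lam}

theorem kbal_card_aux {V : Type*} (G : SimpleGraph V) (k ℓ : ℕ) (α : Fin ℓ → ℕ)
    (i : Fin ℓ → ℕ+) (hi : StrictMono i) :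
    Nat.card {f : V → Fin ℓ // ((∀ ⦃u v⦄, G.Adj u v → f u ≠ f v) ∧
        KBalancedRel G (fun u v => f u < f v) k) ∧ Set.range f = Set.univ ∧
        ∀ t : Fin ℓ, Nat.card {v : V // f v = t} = α t} =
      Nat.card {κ : V → ℕ+ // IsKBalancedColoring G k κ ∧ Set.range κ = Set.range i ∧
        ∀ t : Fin ℓ, Nat.card {v : V // κ v = i t} = α t} := by
  have key : ∀ f : V → Fin ℓ, (((∀ ⦃u v⦄, G.Adj u v → f u ≠ f v) ∧
        KBalancedRel G (fun u v => f u < f v) k) ∧ Set.range f = Set.univ ∧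
        ∀ t : Fin ℓ, Nat.card {v : V // f v = t} = α t) ↔
      (IsKBalancedColoring G k (i ∘ f) ∧ Set.range (i ∘ f) = Set.range i ∧
        ∀ t : Fin ℓ, Nat.card {v : V // (i ∘ f) v = i t} = α t) := by
    intro f
    have h : Set.range (i ∘ f) = Set.range i ↔ Set.range f = Set.univ := by
      rw [Set.range_comp, ← Set.image_univ (f := i), hi.injective.image_injective.eq_iff]
    rw [h]
    simp only [IsKBalancedColoring, IsProperColoring, Function.comp_apply, hi.lt_iff_lt,
      hi.injective.eq_iff, ne_eq]
  refine Nat.card_congr (Equiv.ofBijective (fun f => ⟨i ∘ f.1, (key f.1).1 f.2⟩) ⟨?_, ?_⟩)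
  · intro f g h
    apply Subtype.ext
    exact hi.injective.comp_left (congrArg Subtype.val h)
  · rintro ⟨κ, hκ⟩
    have hr : ∀ v, ∃ t, i t = κ v := fun v => by
      have : κ v ∈ Set.range i := hκ.2.1 ▸ Set.mem_range_self v
      exact this
    choose f hf using hr
    obtain rfl : i ∘ f = κ := funext hf
    exact ⟨⟨f, (key f).2 hκ⟩, rfl⟩

/-- If `τ : ℙ → ℙ` is strictly increasing and `κ` is a `k`-balanced coloring
of `G`, then `τ ∘ κ` is a `k`-balanced coloring inducing the same orientation.  Consequently,
for a composition `α = (α_1, …, α_ℓ)` and increasing color sequences `i`, `j`, the number of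
`k`-balanced colorings using exactly the colors `{i_1,…,i_ℓ}` with `α_t` vertices colored `i_t`
equals the corresponding number for `j`: the function `X_G^k` is quasisymmetric. -/
theorem stmt0 {V : Type*} [Fintype V] (G : SimpleGraph V) (k : ℕ) (hk : 1 ≤ k) :
    (∀ τ : ℕ+ → ℕ+, StrictMono τ → ∀ κ : V → ℕ+, IsKBalancedColoring G k κ →
      IsKBalancedColoring G k (τ ∘ κ) ∧
      ∀ u v, G.Adj u v → (κ u < κ v ↔ τ (κ u) < τ (κ v))) ∧
    (∀ (ℓ : ℕ) (α : Fin ℓ → ℕ), (∀ t, 0 < α t) → (∑ t, α t = Fintype.card V) →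
      ∀ (i j : Fin ℓ → ℕ+), StrictMono i → StrictMono j →
      Nat.card {κ : V → ℕ+ // IsKBalancedColoring G k κ ∧ Set.range κ = Set.range i ∧
        ∀ t : Fin ℓ, Nat.card {v : V // κ v = i t} = α t} =
      Nat.card {κ : V → ℕ+ // IsKBalancedColoring G k κ ∧ Set.range κ = Set.range j ∧
        ∀ t : Fin ℓ, Nat.card {v : V // κ v = j t} = α t}) := by
  refine ⟨?_, ?_⟩
  · intro τ hτ κ hκ
    refine ⟨?_, fun u v _ => hτ.lt_iff_lt.symm⟩
    simpa only [IsKBalancedColoring, IsProperColoring, Function.comp_apply, hτ.lt_iff_lt,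
      hτ.injective.eq_iff, ne_eq] using hκ
  · intro ℓ α _ _ i j hi hj
    rw [← kbal_card_aux G k ℓ α i hi, ← kbal_card_aux G k ℓ α j hj]
end

section
/- Let G be a finite simple graph and let O be an acyclic orientation of G. Then the directed edges of O are precisely the covering relations of the induced poset P_O if and only if O is 2-balanced. -/
theorem aux_split {V : Type*} {G : SimpleGraph V} {u w : V} (p : G.Walk u w) (d : G.Dart)
    (hd : d ∈ p.darts) : ∃ (q1 : G.Walk u d.fst) (q2 : G.Walk d.snd w),
      p.darts = q1.darts ++ d :: q2.darts := by
  induction p with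
  | nil => simp at hd
  | cons h q ih =>
    rw [SimpleGraph.Walk.darts_cons, List.mem_cons] at hd
    rcases hd with rfl | hd
    · exact ⟨SimpleGraph.Walk.nil, q, by simp⟩
    · obtain ⟨q1, q2, e⟩ := ih hd
      exact ⟨SimpleGraph.Walk.cons h q1, q2, by simp [e]⟩

theorem aux_back {V : Type*} {G : SimpleGraph V} (r : V → V → Prop) {u w : V} (p : G.Walk u w)
    (hp : ∀ d ∈ p.darts, r d.snd d.fst) :
    (p.darts.length = 0 ∧ u = w) ∨ (1 ≤ p.darts.length ∧ Relation.TransGen r w u) := by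
  induction p with
  | nil => simp
  | cons h q ih =>
    right
    simp only [SimpleGraph.Walk.darts_cons, List.mem_cons, forall_eq_or_imp] at hp
    refine ⟨by simp, ?_⟩
    rcases ih hp.2 with ⟨_, rfl⟩ | ⟨_, h2⟩
    · exact .single hp.1
    · exact h2.tail hp.1

theorem aux_back2 {V : Type*} {G : SimpleGraph V} (r : V → V → Prop) {u w : V} (p : G.Walk u w)
    (hp : ∀ d ∈ p.darts, r d.snd d.fst) (hl : 2 ≤ p.darts.length) :
    ∃ z, Relation.TransGen r w z ∧ Relation.TransGen r z u := by
  cases p with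
  | nil => simp at hl
  | cons h q =>
    simp only [SimpleGraph.Walk.darts_cons, List.mem_cons, forall_eq_or_imp,
      List.length_cons] at hp hl
    rcases aux_back r q hp.2 with ⟨h0, _⟩ | ⟨_, h2⟩
    · omega
    · exact ⟨_, h2, .single hp.1⟩

theorem aux_count {V : Type*} {G : SimpleGraph V} (r : V → V → Prop)
    (hr : ∀ i j, G.Adj i j → ¬ r i j → r j i)
    (hirr : ∀ i, ¬ Relation.TransGen r i i)
    (hz : ∀ i j z, r i j → Relation.TransGen r i z → Relation.TransGen r z j → False)
    {v : V} (c : G.Walk v v) (hc : c.IsCycle) : 2 ≤ fwdCount r c := by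
  classical
  have h3 : 3 ≤ c.darts.length := by simpa using hc.three_le_length
  by_contra hlt
  by_cases hall : ∀ d ∈ c.darts, ¬ r d.fst d.snd
  · rcases aux_back r c (fun d hd => hr _ _ d.adj (hall d hd)) with h | h
    · omega
    · exact hirr _ h.2
  · push Not at hall
    obtain ⟨d, hd, hrd⟩ := hall
    obtain ⟨q1, q2, e⟩ := aux_split c d hd
    unfold fwdCount at hlt
    rw [e, List.filter_append, List.filter_cons_of_pos (by simpa using hrd), List.length_append,
      List.length_cons] at hlt
    have e1 := List.length_eq_zero_iff.1 (show (q1.darts.filter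
      fun d => decide (r d.toProd.1 d.toProd.2)).length = 0 by
        refine Nat.eq_zero_of_not_pos fun h => hlt ?_
        convert (show 2 ≤ _ + (_ + 1) by omega) using 0)
    have e2 := List.length_eq_zero_iff.1 (show (q2.darts.filter
      fun d => decide (r d.toProd.1 d.toProd.2)).length = 0 by
        refine Nat.eq_zero_of_not_pos fun h => hlt ?_
        convert (show 2 ≤ _ + (_ + 1) by omega) using 0)
    simp only [List.filter_eq_nil_iff, decide_eq_true_eq] at e1 e2
    have b1 : ∀ d ∈ q1.darts, r d.snd d.fst := fun d hd => hr _ _ d.adj (e1 d hd)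
    have b2 : ∀ d ∈ q2.darts, r d.snd d.fst := fun d hd => hr _ _ d.adj (e2 d hd)
    have hl : q1.darts.length + (q2.darts.length + 1) = c.darts.length := by rw [e]; simp
    rcases aux_back r q1 b1 with ⟨l1, t1⟩ | ⟨l1, t1⟩
    · obtain ⟨z, hz1, hz2⟩ := aux_back2 r q2 b2 (by omega)
      rw [t1] at hz1
      exact hz _ _ z hrd hz1 hz2
    · rcases aux_back r q2 b2 with ⟨l2, t2⟩ | ⟨l2, t2⟩
      · obtain ⟨z, hz1, hz2⟩ := aux_back2 r q1 b1 (by omega)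
        rw [← t2] at hz2
        exact hz _ _ z hrd hz1 hz2
      · exact hz _ _ v hrd t1 t2

theorem aux_fwd_reach {V : Type*} {G : SimpleGraph V} (r : V → V → Prop) {u w : V}
    (p : G.Walk u w) (hp : ∀ d ∈ p.darts, r d.fst d.snd) :
    ∀ x ∈ p.support, Relation.ReflTransGen r u x := by
  induction p with
  | nil => intro x hx; simp at hx; subst hx; exact .refl
  | cons h q ih =>
    intro x hx
    simp only [SimpleGraph.Walk.darts_cons, List.mem_cons, forall_eq_or_imp] at hp
    rw [SimpleGraph.Walk.support_cons, List.mem_cons] at hx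
    rcases hx with rfl | hx
    · exact .refl
    · exact .head hp.1 (ih hp.2 x hx)

theorem aux_fwd_path {V : Type*} {G : SimpleGraph V} (r : V → V → Prop)
    (hirr : ∀ i, ¬ Relation.TransGen r i i) {u w : V}
    (p : G.Walk u w) (hp : ∀ d ∈ p.darts, r d.fst d.snd) : p.IsPath := by
  induction p with
  | nil => simp
  | cons h q ih =>
    simp only [SimpleGraph.Walk.darts_cons, List.mem_cons, forall_eq_or_imp] at hp
    rw [SimpleGraph.Walk.cons_isPath_iff]
    exact ⟨ih hp.2, fun hx => hirr _ (Relation.TransGen.head' hp.1 (aux_fwd_reach r q hp.2 _ hx))⟩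

theorem aux_fwd_exists {V : Type*} {G : SimpleGraph V} (r : V → V → Prop)
    (hadj : ∀ i j, r i j → G.Adj i j) {u w : V} (h : Relation.ReflTransGen r u w) :
    ∃ p : G.Walk u w, ∀ d ∈ p.darts, r d.fst d.snd := by
  induction h using Relation.ReflTransGen.head_induction_on with
  | refl => exact ⟨.nil, by simp⟩
  | head h _ ih =>
    obtain ⟨p, hp⟩ := ih
    exact ⟨.cons (hadj _ _ h) p, by simpa using ⟨h, hp⟩⟩

/-- For an acyclic orientation `O` of `G`, the directed edges of `O` are
precisely the covering relations of the induced poset `P_O` (whose strict order is the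
transitive closure of the edge relation) if and only if `O` is 2-balanced. -/
theorem stmt2 {V : Type*} [Fintype V] (G : SimpleGraph V) (O : GraphOrientation G)
    (hacyc : O.Acyclic) :
    (∀ i j : V, O.dir i j ↔
      (Relation.TransGen O.dir i j ∧
        ¬ ∃ z : V, Relation.TransGen O.dir i z ∧ Relation.TransGen O.dir z j)) ↔
    O.KBalanced 2 := by
  have hasym : ∀ i j, O.dir i j → ¬ O.dir j i := fun i j h => (O.exactlyOne (O.dir_adj h)).1 h
  constructor
  · intro H v c hc
    have hz : ∀ i j z, O.dir i j → Relation.TransGen O.dir i z → Relation.TransGen O.dir z j →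
        False := fun i j z h h1 h2 => ((H i j).1 h).2 ⟨z, h1, h2⟩
    have hr : ∀ i j, G.Adj i j → ¬ O.dir i j → O.dir j i := fun i j h h1 =>
      (O.exactlyOne h.symm).2 h1
    refine ⟨aux_count O.dir hr (fun i => by first | exact hacyc i | exact hacyc.irrefl i) hz c hc, ?_⟩
    have sw : ∀ a b, Relation.TransGen (fun i j => O.dir j i) a b → Relation.TransGen O.dir b a :=
      fun a b h => Relation.transGen_swap.1 h
    exact aux_count (fun i j => O.dir j i) (fun i j h h1 => hr j i h.symm h1)
      (fun i h => by first | exact hacyc i (sw _ _ h) | exact hacyc.irrefl i (sw _ _ h))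
      (fun i j z h h1 h2 => hz j i z h (sw _ _ h2) (sw _ _ h1)) c hc
  · intro H i j
    have hirr : ∀ i, ¬ Relation.TransGen O.dir i i :=
      fun i => by first | exact hacyc i | exact hacyc.irrefl i
    constructor
    · intro hij
      refine ⟨.single hij, ?_⟩
      rintro ⟨z, h1, h2⟩
      obtain ⟨k, hik, hkz⟩ := Relation.TransGen.head'_iff.1 h1
      have hkj : Relation.TransGen O.dir k j := Relation.TransGen.trans_right hkz h2
      have hne : k ≠ j := by rintro rfl; exact hirr _ hkj
      obtain ⟨q, hq⟩ := aux_fwd_exists O.dir (fun _ _ h => O.dir_adj h) hkj.to_reflTransGen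
      have hp : ∀ d ∈ (SimpleGraph.Walk.cons (O.dir_adj hik) q).darts, O.dir d.fst d.snd := by
        simpa using ⟨hik, hq⟩
      have hpath := aux_fwd_path O.dir hirr _ hp
      have hcyc : (SimpleGraph.Walk.cons (O.dir_adj hij).symm
          (SimpleGraph.Walk.cons (O.dir_adj hik) q)).IsCycle := by
        rw [SimpleGraph.Walk.cons_isCycle_iff]
        refine ⟨hpath, ?_⟩
        rw [SimpleGraph.Walk.cons_isPath_iff] at hpath
        rw [SimpleGraph.Walk.edges_cons, List.mem_cons, not_or]
        refine ⟨fun h => ?_, fun h => hpath.2 (q.snd_mem_support_of_mem_edges h)⟩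
        rw [Sym2.eq_iff] at h
        rcases h with ⟨rfl, _⟩ | ⟨h, _⟩
        · exact hirr _ (.single (by assumption))
        · exact hne h.symm
      have h2 := (H _ hcyc).2
      unfold fwdCount at h2
      rw [SimpleGraph.Walk.darts_cons, List.filter_cons_of_pos (by simpa using hij),
        List.filter_eq_nil_iff.2 (fun d hd => by simpa using hasym _ _ (hp d hd))] at h2
      simp at h2
    · rintro ⟨h, hn⟩
      obtain ⟨k, hik, hkj⟩ := Relation.TransGen.head'_iff.1 h
      rcases Relation.reflTransGen_iff_eq_or_transGen.1 hkj with rfl | hkj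
      · exact hik
      · exact absurd ⟨k, .single hik, hkj⟩ hn
end

section
/- Let P be a partial order on [n] = {1, …, n} that is naturally labelled, i.e., i <_P j implies i < j as integers. A map τ : [n] → ℙ is a P-partition (i.e., i <_P j implies τ(i) < τ(j)) if and only if τ is π-compatible for some linear extension π of P; moreover, such a permutation π is unique. Hence the set of P-partitions is the disjoint union, over all linear extensions π of P, of the sets of π-compatible functions. -/
/-- A function `f : [n] → ℙ` is `π`-compatible: reading the values along the list
`π 0, π 1, …, π (n-1)` gives a weakly increasing sequence which increases strictly
at each ascent of `π` (i.e. whenever `π t < π (t+1)` as integers). -/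
def PiCompatible {n : ℕ} (π : Equiv.Perm (Fin n)) (f : Fin n → ℕ+) : Prop :=
  ∀ (t : ℕ) (h : t + 1 < n),
    f (π ⟨t, Nat.lt_of_succ_lt h⟩) ≤ f (π ⟨t + 1, h⟩) ∧
    ((π ⟨t, Nat.lt_of_succ_lt h⟩ : Fin n) < π ⟨t + 1, h⟩ →
      f (π ⟨t, Nat.lt_of_succ_lt h⟩) < f (π ⟨t + 1, h⟩))

/-- `π` is a linear extension of the partial order `P` on `[n]`:
if `i <_P j` then `i` appears before `j` in the list `π 0, …, π (n-1)`. -/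
def IsLinearExtension {n : ℕ} (P : PartialOrder (Fin n)) (π : Equiv.Perm (Fin n)) : Prop :=
  ∀ i j : Fin n, P.lt i j → π.symm i < π.symm j

def gkey {n : ℕ} (τ : Fin n → ℕ+) (i : Fin n) : ℕ+ ×ₗ (Fin n)ᵒᵈ :=
  toLex (τ i, OrderDual.toDual i)

theorem gkey_lt {n : ℕ} (τ : Fin n → ℕ+) (i j : Fin n) :
    gkey τ i < gkey τ j ↔ τ i < τ j ∨ (τ i = τ j ∧ j < i) := by
  simp [gkey, Prod.Lex.toLex_lt_toLex]

theorem gkey_inj {n : ℕ} (τ : Fin n → ℕ+) : Function.Injective (gkey τ) := by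
  intro i j h
  exact congrArg (fun x => OrderDual.ofDual (ofLex x).2) h

theorem compat_iff {n : ℕ} (π : Equiv.Perm (Fin n)) (τ : Fin n → ℕ+) :
    PiCompatible π τ ↔ StrictMono (gkey τ ∘ π) := by
  constructor
  · intro h
    cases n with
    | zero => intro a; exact a.elim0
    | succ m =>
      rw [Fin.strictMono_iff_lt_succ]
      intro i
      obtain ⟨h1, h2⟩ := h i.1 (by omega)
      change gkey τ (π i.castSucc) < gkey τ (π i.succ)
      rw [gkey_lt]
      change τ (π i.castSucc) ≤ τ (π i.succ) at h1
      change π i.castSucc < π i.succ → τ (π i.castSucc) < τ (π i.succ) at h2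
      rcases h1.lt_or_eq with h3 | h3
      · exact Or.inl h3
      · refine Or.inr ⟨h3, ?_⟩
        have hne : π i.castSucc ≠ π i.succ := fun e =>
          (Fin.castSucc_lt_succ (i := i)).ne (π.injective e)
        rcases lt_or_gt_of_ne hne with h4 | h4
        · exact absurd h3 (h2 h4).ne
        · exact h4
  · intro h t ht
    have h1 : gkey τ (π ⟨t, Nat.lt_of_succ_lt ht⟩) < gkey τ (π ⟨t + 1, ht⟩) :=
      h (Fin.mk_lt_mk.2 (Nat.lt_succ_self t))
    rw [gkey_lt] at h1
    rcases h1 with h1 | ⟨h1, h2⟩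
    · exact ⟨h1.le, fun _ => h1⟩
    · exact ⟨h1.le, fun h3 => absurd h3 h2.asymm⟩

theorem stmt_aux {n : ℕ} (R : Fin n → Fin n → Prop)
    (hnat : ∀ i j : Fin n, R i j → i < j) (τ : Fin n → ℕ+) :
    (∀ i j : Fin n, R i j → τ i < τ j) ↔
      ∃! π : Equiv.Perm (Fin n),
        (∀ i j : Fin n, R i j → π.symm i < π.symm j) ∧ PiCompatible π τ := by
  constructor
  · intro hτ
    have hs : StrictMono (gkey τ ∘ Tuple.sort (gkey τ)) :=
      (Tuple.monotone_sort (gkey τ)).strictMono_of_injective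
        ((gkey_inj τ).comp (Tuple.sort (gkey τ)).injective)
    refine ⟨Tuple.sort (gkey τ), ⟨?_, (compat_iff _ _).2 hs⟩, ?_⟩
    · intro i j hij
      rw [← hs.lt_iff_lt]
      simp only [Function.comp_apply, Equiv.apply_symm_apply]
      exact (gkey_lt τ i j).2 (Or.inl (hτ i j hij))
    · rintro σ ⟨-, hσ⟩
      have h := Tuple.unique_monotone ((compat_iff _ _).1 hσ).monotone hs.monotone
      ext i
      exact congrArg Fin.val (gkey_inj τ (congrFun h i))
  · rintro ⟨π, ⟨hl, hc⟩, -⟩ i j hij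
    have h := (compat_iff _ _).1 hc (hl i j hij)
    simp only [Function.comp_apply, Equiv.apply_symm_apply] at h
    rcases (gkey_lt τ i j).1 h with h | ⟨-, h⟩
    · exact h
    · exact absurd h (hnat i j hij).asymm

/-- Let `P` be a naturally labelled partial order on `[n]`.  A map
`τ : [n] → ℙ` is a `P`-partition iff it is `π`-compatible for some linear extension `π`
of `P`, and this `π` is unique; hence the set of `P`-partitions is the disjoint union over
linear extensions `π` of the sets of `π`-compatible functions. -/
theorem stmt4 {n : ℕ} (P : PartialOrder (Fin n))
    (hnat : ∀ i j : Fin n, P.lt i j → i < j) (τ : Fin n → ℕ+) :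
    (∀ i j : Fin n, P.lt i j → τ i < τ j) ↔
      ∃! π : Equiv.Perm (Fin n), IsLinearExtension P π ∧ PiCompatible π τ := by
  exact stmt_aux P.lt hnat τ
end

section
/- Let G be a finite simple graph and k ≥ 1. For each k-balanced orientation O of G, the set of k-balanced colorings κ of G with O_κ = O is exactly the set of strictly order-preserving maps from the induced poset P_O to ℙ (maps τ with τ(i) < τ(j) whenever i <_{P_O} j). Consequently, the set of all k-balanced colorings of G is the disjoint union, over all k-balanced orientations O of G, of the sets of strictly order-preserving maps P_O → ℙ. -/
theorem fwdCount_congr_aux {V : Type*} {G : SimpleGraph V} {v : V}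
    (r s : V → V → Prop) (h : ∀ i j, G.Adj i j → (r i j ↔ s i j)) (c : G.Walk v v) :
    fwdCount r c = fwdCount s c := by
  classical
  unfold fwdCount
  congr 1
  apply List.filter_congr
  intro d _
  simp [h _ _ d.adj]

theorem KBalancedRel_congr_aux {V : Type*} {G : SimpleGraph V}
    (r s : V → V → Prop) (h : ∀ i j, G.Adj i j → (r i j ↔ s i j)) (k : ℕ) :
    KBalancedRel G r k ↔ KBalancedRel G s k := by
  unfold KBalancedRel
  have h1 := fun (v : V) (c : G.Walk v v) => fwdCount_congr_aux r s h c
  have h2 := fun (v : V) (c : G.Walk v v) =>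
    fwdCount_congr_aux (fun i j => r j i) (fun i j => s j i) (fun i j hij => h j i hij.symm) c
  simp only [h1, h2]

theorem dir_iff_aux {V : Type*} {G : SimpleGraph V} (O : GraphOrientation G) (κ : V → ℕ+)
    (h : ∀ i j : V, Relation.TransGen O.dir i j → κ i < κ j) (i j : V) (hij : G.Adj i j) :
    O.dir i j ↔ κ i < κ j := by
  constructor
  · intro hd
    exact h i j (Relation.TransGen.single hd)
  · intro hlt
    rw [O.exactlyOne hij]
    intro hd
    exact lt_asymm hlt (h j i (Relation.TransGen.single hd))

theorem trans_aux {V : Type*} {G : SimpleGraph V} (O : GraphOrientation G) (κ : V → ℕ+)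
    (h : ∀ i j : V, O.dir i j → κ i < κ j) (i j : V) (hij : Relation.TransGen O.dir i j) :
    κ i < κ j := by
  induction hij with
  | single hd => exact h _ _ hd
  | tail _ hd ih => exact ih.trans (h _ _ hd)

theorem balanced_aux {V : Type*} {G : SimpleGraph V} (O : GraphOrientation G) (k : ℕ)
    (hO : O.KBalanced k) (κ : V → ℕ+)
    (h : ∀ i j : V, Relation.TransGen O.dir i j → κ i < κ j) : IsKBalancedColoring G k κ := by
  have hd := dir_iff_aux O κ h
  refine ⟨fun i j hij heq => ?_, (KBalancedRel_congr_aux _ _ hd k).1 hO⟩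
  have h1 := hd i j hij
  have h2 := hd j i hij.symm
  have h3 := O.exactlyOne hij
  rw [h1, h2, heq] at h3
  simp at h3

/-- For each `k`-balanced orientation `O` of `G`, the `k`-balanced colorings
`κ` with induced orientation `O_κ = O` are exactly the strictly order-preserving maps from the
induced poset `P_O` (strict order: transitive closure of the edge relation of `O`) to `ℙ`.
Consequently every `k`-balanced coloring is a strictly order-preserving map on `P_O` for a
unique `k`-balanced orientation `O`. -/
theorem stmt5 {V : Type*} [Fintype V] (G : SimpleGraph V) (k : ℕ) (hk : 1 ≤ k) :
    (∀ O : GraphOrientation G, O.KBalanced k → ∀ κ : V → ℕ+,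
      ((IsKBalancedColoring G k κ ∧ ∀ i j : V, G.Adj i j → (O.dir i j ↔ κ i < κ j)) ↔
        (∀ i j : V, Relation.TransGen O.dir i j → κ i < κ j))) ∧
    (∀ κ : V → ℕ+, IsKBalancedColoring G k κ ↔
      ∃! O : GraphOrientation G, O.KBalanced k ∧
        ∀ i j : V, Relation.TransGen O.dir i j → κ i < κ j) := by
  refine ⟨fun O hO κ => ⟨?_, fun h => ⟨balanced_aux O k hO κ h, dir_iff_aux O κ h⟩⟩,
    fun κ => ⟨?_, ?_⟩⟩
  · rintro ⟨_, h⟩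
    exact trans_aux O κ fun i j hd => (h i j (O.dir_adj hd)).1 hd
  · rintro ⟨hp, hb⟩
    refine ⟨⟨fun i j => G.Adj i j ∧ κ i < κ j, fun i j h => h.1, ?_⟩, ⟨?_, ?_⟩, ?_⟩
    · intro i j hij
      have := hp hij
      simp only [hij, hij.symm, true_and, not_lt]
      exact ⟨le_of_lt, fun h => lt_of_le_of_ne h this⟩
    · refine (KBalancedRel_congr_aux _ _ (fun i j hij => ?_) k).1 hb
      simp [hij]
    · exact trans_aux _ κ fun i j hd => hd.2
    · rintro ⟨d, ha, he⟩ ⟨_, h⟩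
      have hd := dir_iff_aux _ κ h
      congr 1
      funext i j
      apply propext
      exact ⟨fun h => ⟨ha h, (hd i j (ha h)).1 h⟩, fun h => (hd i j h.1).2 h.2⟩
  · rintro ⟨O, ⟨hO, h⟩, _⟩
    exact balanced_aux O k hO κ h
end

section
/- Let C_n be the cycle graph on n ≥ 3 vertices. A proper coloring κ of C_n fails to be 2-balanced if and only if the vertices of C_n can be listed in cyclic order around the cycle as v_1, v_2, …, v_n with κ(v_1) < κ(v_2) < ⋯ < κ(v_n). In particular, for any fixed set of n distinct colors, exactly 2n of the proper colorings of C_n using each of these colors exactly once fail to be 2-balanced. -/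
open SimpleGraph in
open Fin.CommRing in
lemma aux_seq (m : ℕ) (g : ℕ → Fin (m+3)) (L : ℕ)
    (hadj : ∀ t < L, (cycleGraph (m+3)).Adj (g t) (g (t+1)))
    (hne : ∀ t, t + 2 ≤ L → g t ≠ g (t+2)) :
    (∀ t ≤ L, g t = g 0 + (t : Fin (m+3))) ∨ (∀ t ≤ L, g t = g 0 - (t : Fin (m+3))) := by
  have hstep : ∀ t < L, g (t+1) = g t + 1 ∨ g (t+1) = g t - 1 := by
    intro t ht
    have h := hadj t ht
    rw [cycleGraph_adj] at h
    rcases h with h | h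
    · right; rw [← h]; ring
    · left; rw [← h]; ring
  have hs : (∀ t < L, g (t+1) = g t + 1) ∨ (∀ t < L, g (t+1) = g t - 1) := by
    rcases Nat.eq_zero_or_pos L with h0 | h0
    · left; intro t ht; omega
    rcases hstep 0 h0 with h | h
    · left
      intro t
      induction t with
      | zero => intro _; exact h
      | succ t ih =>
        intro ht
        rcases hstep (t+1) ht with h1 | h1
        · exact h1
        · exfalso
          apply hne t (by omega)
          rw [show t + 2 = t + 1 + 1 from rfl, h1, ih (by omega)]; ring
    · right
      intro t
      induction t with
      | zero => intro _; exact h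
      | succ t ih =>
        intro ht
        rcases hstep (t+1) ht with h1 | h1
        · exfalso
          apply hne t (by omega)
          rw [show t + 2 = t + 1 + 1 from rfl, h1, ih (by omega)]; ring
        · exact h1
  rcases hs with hs | hs
  · left
    intro t
    induction t with
    | zero => intro _; simp
    | succ t ih => intro ht; rw [hs t (by omega), ih (by omega)]; push_cast; ring
  · right
    intro t
    induction t with
    | zero => intro _; simp
    | succ t ih => intro ht; rw [hs t (by omega), ih (by omega)]; push_cast; ring

open SimpleGraph in
open Fin.CommRing in
lemma aux_cycle (m : ℕ) {v : Fin (m+3)} (c : (cycleGraph (m+3)).Walk v v) (hc : c.IsCycle) :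
    c.length = m + 3 ∧ ((∀ t ≤ m+3, c.getVert t = v + (t : Fin (m+3))) ∨
      (∀ t ≤ m+3, c.getVert t = v - (t : Fin (m+3)))) := by
  have h3 := hc.three_le_length
  have hle : c.length ≤ m + 3 := by
    have h := hc.support_nodup.length_le_card
    simpa using h
  have hs := aux_seq m c.getVert c.length (fun t ht => c.adj_getVert_succ ht) (by
    intro t ht he
    rcases Nat.eq_zero_or_pos t with h0 | h0
    · subst h0
      have := hc.getVert_injOn' (show 0 ∈ {i | i ≤ c.length - 1} by simp)
        (show 0 + 2 ∈ {i | i ≤ c.length - 1} by simp; omega) he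
      omega
    · have := hc.getVert_injOn (show t ∈ {i | 1 ≤ i ∧ i ≤ c.length} from ⟨h0, by omega⟩)
        (show t + 2 ∈ {i | 1 ≤ i ∧ i ≤ c.length} from ⟨by omega, ht⟩) he
      omega)
  have hlen : c.length = m + 3 := by
    have hz : ((c.length : ℕ) : Fin (m+3)) = 0 := by
      rcases hs with hs | hs
      · have := hs c.length le_rfl
        simpa using this
      · have := hs c.length le_rfl
        rw [c.getVert_length, c.getVert_zero] at this
        exact sub_eq_self.mp this.symm
    have h2 := congrArg Fin.val hz
    simp only [Fin.val_natCast, Fin.val_zero] at h2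
    have := Nat.le_of_dvd (by omega) (Nat.dvd_of_mod_eq_zero h2)
    omega
  refine ⟨hlen, ?_⟩
  rw [hlen] at hs
  simpa using hs

open Classical in
lemma aux_count_s6 {V : Type*} {G : SimpleGraph V} {v : V} (r : V → V → Prop) (c : G.Walk v v) :
    fwdCount r c = ∑ t ∈ Finset.range c.length,
      if r (c.getVert t) (c.getVert (t+1)) then 1 else 0 := by
  have h : c.darts.map (fun d => d.toProd)
      = (List.range c.length).map (fun t => (c.getVert t, c.getVert (t+1))) := by
    apply List.ext_getElem
    · simp
    · intro i h1 h2
      simp [SimpleGraph.Walk.darts_getElem_eq_getVert]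
  have h' := congrArg (fun l => (l.filter (fun p : V × V => decide (r p.1 p.2))).length) h
  simp only [List.filter_map, List.length_map] at h'
  rw [← Finset.card_filter]
  unfold fwdCount
  exact h'

open Classical in
/-- number of forward edges in the cycle. -/
noncomputable def auxA (m : ℕ) (r : Fin (m+3) → Fin (m+3) → Prop) : ℕ :=
  ∑ i : Fin (m+3), if r i (i+1) then 1 else 0

open SimpleGraph in
open Fin.CommRing in
lemma aux_fwd (m : ℕ) {v : Fin (m+3)} (c : (cycleGraph (m+3)).Walk v v) (hc : c.IsCycle) :
    (∀ r, fwdCount r c = auxA m r) ∨ (∀ r, fwdCount r c = auxA m (fun i j => r j i)) := by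
  classical
  obtain ⟨hl, h | h⟩ := aux_cycle m c hc
  · left
    intro r
    rw [aux_count_s6, hl, Finset.sum_range]
    unfold auxA
    refine Eq.trans ?_ (Equiv.sum_comp (Equiv.addLeft v) _)
    apply Finset.sum_congr rfl
    intro t _
    rw [h _ (by omega), h _ (by omega)]
    simp [add_assoc]
  · right
    intro r
    rw [aux_count_s6, hl, Finset.sum_range]
    unfold auxA
    refine Eq.trans ?_ (Equiv.sum_comp (Equiv.subLeft (v - 1)) _)
    apply Finset.sum_congr rfl
    intro t _
    rw [h _ (by omega), h _ (by omega)]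
    have e1 : v - 1 - t + 1 = v - t := by ring
    have e2 : v - (t + 1) = v - 1 - t := by ring
    simp [e1, e2]

open SimpleGraph in
lemma aux_bal (m : ℕ) (r : Fin (m+3) → Fin (m+3) → Prop) :
    KBalancedRel (cycleGraph (m+3)) r 2 ↔ 2 ≤ auxA m r ∧ 2 ≤ auxA m (fun i j => r j i) := by
  constructor
  · intro h
    have h1 := h _ (cycleGraph.isCycle_cycle (n := m))
    rcases aux_fwd m _ (cycleGraph.isCycle_cycle (n := m)) with h2 | h2 <;>
      rw [h2, h2] at h1
    · exact h1
    · exact h1.symm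
  · intro h v c hc
    rcases aux_fwd m c hc with h2 | h2 <;> rw [h2, h2]
    · exact h
    · exact h.symm

lemma aux_lt (m : ℕ) (r : Fin (m+3) → Fin (m+3) → Prop) :
    ¬ 2 ≤ auxA m r ↔ ∃ a, ∀ i, i ≠ a → ¬ r i (i+1) := by
  classical
  unfold auxA
  rw [← Finset.card_filter, show (∀ k, ¬ 2 ≤ k ↔ k ≤ 1) by intro k; omega,
    Finset.card_le_one_iff_subset_singleton]
  apply exists_congr
  intro a
  simp only [Finset.subset_iff, Finset.mem_filter, Finset.mem_univ, true_and,
    Finset.mem_singleton]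
  exact forall_congr' fun i => ⟨fun h h1 h2 => h1 (h h2), fun h h1 => by_contra fun h2 => h h2 h1⟩

open Fin.CommRing in
lemma aux_ne_last (m : ℕ) (t : Fin (m+2)) : (t.castSucc : Fin (m+3)) + 1 ≠ 0 := by
  intro h
  rw [Fin.coeSucc_eq_succ] at h
  exact Fin.succ_ne_zero _ h

open SimpleGraph in
open Fin.CommRing in
lemma aux_dihedral (m : ℕ) (v : Equiv.Perm (Fin (m+3)))
    (hv : ∀ t, (cycleGraph (m+3)).Adj (v t) (v (t+1))) :
    (∃ a, ∀ t, v t = a + t) ∨ (∃ a, ∀ t, v t = a - t) := by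
  have := aux_seq m (fun t => v (t : Fin (m+3))) (m+3) (by intro t _; simpa using hv t) (by
    intro t _ h
    have h1 := v.injective h
    push_cast at h1
    have h2 : (2 : Fin (m+3)) = 0 := by
      have : (t : Fin (m+3)) + 0 = t + 2 := by simpa using h1
      exact (add_left_cancel this).symm
    have := congrArg Fin.val h2
    rw [Fin.val_two] at this; simp at this)
  rcases this with h | h
  · left
    refine ⟨v 0, fun t => ?_⟩
    have := h t.val (by omega)
    simpa using this
  · right
    refine ⟨v 0, fun t => ?_⟩
    have := h t.val (by omega)
    simpa using this

open SimpleGraph in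
open Fin.CommRing in
lemma aux_iff (m : ℕ) (κ : Fin (m+3) → ℕ+) (hκ : IsProperColoring (cycleGraph (m+3)) κ) :
    (¬ KBalancedRel (cycleGraph (m+3)) (fun i j => κ i < κ j) 2 ↔
      ((∃ a, StrictMono (fun t => κ (a + t))) ∨ (∃ a, StrictMono (fun t => κ (a - t))))) := by
  have hp : ∀ i, κ i ≠ κ (i+1) := fun i => hκ (by rw [cycleGraph_adj]; right; ring)
  rw [aux_bal, not_and_or, aux_lt, aux_lt, or_comm]
  apply or_congr
  · constructor
    · rintro ⟨a, ha⟩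
      refine ⟨a + 1, Fin.strictMono_iff_lt_succ.mpr fun t => ?_⟩
      rw [← Fin.coeSucc_eq_succ, ← add_assoc]
      apply lt_of_le_of_ne _ (hp _)
      apply not_lt.mp
      apply ha
      intro h
      apply aux_ne_last m t
      have : a + 1 + t.castSucc - a = 0 := by rw [h]; ring
      rw [← this]; ring
    · rintro ⟨a, ha⟩
      refine ⟨a - 1, fun i hi => ?_⟩
      apply not_lt.mpr
      have hl : i - a ≠ Fin.last (m+2) := by
        intro h
        apply hi
        have : i - a + 1 = 0 := by rw [h]; simp
        have h2 : i = (i - a + 1) + a - 1 := by ring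
        rw [h2, this]; ring
      obtain ⟨t, ht⟩ := Fin.exists_castSucc_eq.mpr hl
      have := (Fin.strictMono_iff_lt_succ.mp ha t).le
      rw [← Fin.coeSucc_eq_succ, ht] at this
      convert this using 2 <;> ring
  · constructor
    · rintro ⟨a, ha⟩
      refine ⟨a, Fin.strictMono_iff_lt_succ.mpr fun t => ?_⟩
      rw [← Fin.coeSucc_eq_succ]
      have h1 := hp (a - (t.castSucc + 1))
      have h2 := ha (a - (t.castSucc + 1)) (by
        intro h
        apply aux_ne_last m t
        simpa using h)
      have h3 : a - (t.castSucc + 1) + 1 = a - t.castSucc := by ring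
      rw [h3] at h1 h2
      exact lt_of_le_of_ne (not_lt.mp h2) h1.symm
    · rintro ⟨a, ha⟩
      refine ⟨a, fun i hi => ?_⟩
      apply not_lt.mpr
      have hl : a - i - 1 ≠ Fin.last (m+2) := by
        intro h
        apply hi
        have : a - i - 1 + 1 = 0 := by rw [h]; simp
        have h2 : i = a - (a - i - 1 + 1) := by ring
        rw [h2, this]; ring
      obtain ⟨t, ht⟩ := Fin.exists_castSucc_eq.mpr hl
      have := (Fin.strictMono_iff_lt_succ.mp ha t).le
      rw [← Fin.coeSucc_eq_succ, ht] at this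
      convert this using 2 <;> ring

open SimpleGraph in
open Fin.CommRing in
lemma aux_card (m : ℕ) (S : Finset ℕ+) (hS : S.card = m + 3) :
    Nat.card {κ : Fin (m+3) → ℕ+ //
        IsProperColoring (cycleGraph (m+3)) κ ∧ Function.Injective κ ∧
        (∀ i, κ i ∈ S) ∧
        ¬ KBalancedRel (cycleGraph (m+3)) (fun i j => κ i < κ j) 2} = 2 * (m+3) := by
  have hprop : ∀ κ : Fin (m+3) → ℕ+, Function.Injective κ →
      IsProperColoring (cycleGraph (m+3)) κ := fun κ h i j hij he => hij.ne (h he)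
  let e := S.orderEmbOfFin hS
  have hi1 : ∀ a, Function.Injective (fun i : Fin (m+3) => e (i - a)) := fun a =>
    e.injective.comp sub_left_injective
  have hi2 : ∀ a, Function.Injective (fun i : Fin (m+3) => e (a - i)) := fun a =>
    e.injective.comp sub_right_injective
  let F : Fin (m+3) ⊕ Fin (m+3) → {κ : Fin (m+3) → ℕ+ //
        IsProperColoring (cycleGraph (m+3)) κ ∧ Function.Injective κ ∧
        (∀ i, κ i ∈ S) ∧
        ¬ KBalancedRel (cycleGraph (m+3)) (fun i j => κ i < κ j) 2} := fun x => match x with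
    | .inl a => ⟨fun i => e (i - a), hprop _ (hi1 a), hi1 a,
        fun i => Finset.orderEmbOfFin_mem S hS _, (aux_iff m _ (hprop _ (hi1 a))).mpr
          (Or.inl ⟨a, by simpa using e.strictMono⟩)⟩
    | .inr a => ⟨fun i => e (a - i), hprop _ (hi2 a), hi2 a,
        fun i => Finset.orderEmbOfFin_mem S hS _, (aux_iff m _ (hprop _ (hi2 a))).mpr
          (Or.inr ⟨a, by simpa using e.strictMono⟩)⟩
  have h20 : (2 : Fin (m+3)) ≠ 0 := by
    intro h2
    have := congrArg Fin.val h2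
    rw [Fin.val_two] at this; simp at this
  have key : ∀ a b : Fin (m+3), ¬ ∀ i, e (i - a) = e (b - i) := by
    intro a b h
    have h0 := e.injective (h 0)
    have h1 := e.injective (h 1)
    apply h20
    have : (2 : Fin (m+3)) = (1 - a) - (0 - a) + ((b - 0) - (b - 1)) := by ring
    rw [this, h1, h0]; ring
  have hF : Function.Bijective F := by
    constructor
    · rintro (a | a) (b | b) hab
      · have := e.injective (congrFun (congrArg Subtype.val hab) 0)
        simpa using this
      · exact (key a b (fun i => congrFun (congrArg Subtype.val hab) i)).elim
      · exact (key b a (fun i => (congrFun (congrArg Subtype.val hab) i).symm)).elim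
      · have := e.injective (congrFun (congrArg Subtype.val hab) 0)
        simpa using this
    · rintro ⟨κ, h1, h2, h3, h4⟩
      rcases (aux_iff m κ h1).mp h4 with ⟨a, ha⟩ | ⟨a, ha⟩
      · refine ⟨.inl a, Subtype.ext (funext fun i => ?_)⟩
        have := Finset.orderEmbOfFin_unique hS (fun t => h3 (a + t)) ha
        have := congrFun this (i - a)
        simp only [add_sub_cancel] at this
        exact this.symm
      · refine ⟨.inr a, Subtype.ext (funext fun i => ?_)⟩
        have := Finset.orderEmbOfFin_unique hS (fun t => h3 (a - t)) ha
        have := congrFun this (a - i)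
        simp only [sub_sub_cancel] at this
        exact this.symm
  rw [← Nat.card_eq_of_bijective F hF]
  simp [two_mul]

/-- A proper coloring `κ` of the cycle `C_n` (`n ≥ 3`) fails to be 2-balanced
iff the vertices can be listed in cyclic order `v_1, …, v_n` around the cycle with
`κ(v_1) < κ(v_2) < ⋯ < κ(v_n)`.  In particular, for any fixed set of `n` distinct colors,
exactly `2n` of the proper colorings using each of these colors exactly once fail to be
2-balanced. -/
theorem stmt6 (n : ℕ) (hn : 3 ≤ n) :
    (∀ κ : Fin n → ℕ+, IsProperColoring (SimpleGraph.cycleGraph n) κ →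
      (¬ KBalancedRel (SimpleGraph.cycleGraph n) (fun i j => κ i < κ j) 2 ↔
        ∃ v : Equiv.Perm (Fin n),
          (∀ t : Fin n, (SimpleGraph.cycleGraph n).Adj (v t) (v (t + ⟨1, by omega⟩))) ∧
          StrictMono (κ ∘ v))) ∧
    (∀ S : Finset ℕ+, S.card = n →
      Nat.card {κ : Fin n → ℕ+ //
        IsProperColoring (SimpleGraph.cycleGraph n) κ ∧ Function.Injective κ ∧
        (∀ i, κ i ∈ S) ∧
        ¬ KBalancedRel (SimpleGraph.cycleGraph n) (fun i j => κ i < κ j) 2} = 2 * n) := by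
  obtain ⟨m, rfl⟩ : ∃ m, n = m + 3 := ⟨n - 3, by omega⟩
  refine ⟨fun κ hκ => ?_, fun S hS => aux_card m S hS⟩
  rw [aux_iff m κ hκ]
  have h1 : (⟨1, by omega⟩ : Fin (m+3)) = 1 := by ext; simp
  constructor
  · rintro (⟨a, ha⟩ | ⟨a, ha⟩)
    · refine ⟨Equiv.addLeft a, fun t => ?_, ha⟩
      rw [h1, SimpleGraph.cycleGraph_adj]
      right
      simp only [Equiv.coe_addLeft]
      abel
    · refine ⟨Equiv.subLeft a, fun t => ?_, ha⟩
      rw [h1, SimpleGraph.cycleGraph_adj]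
      left
      simp only [Equiv.subLeft_apply]
      abel
  · rintro ⟨v, hv, hm⟩
    rw [h1] at hv
    rcases aux_dihedral m v hv with ⟨a, ha⟩ | ⟨a, ha⟩
    · left
      refine ⟨a, ?_⟩
      simp only [← ha]
      exact hm
    · right
      refine ⟨a, ?_⟩
      simp only [← ha]
      exact hm
end

section
/- Let C_n be the cycle graph on n ≥ 3 vertices and let α = (α_1, …, α_ℓ) be a composition of n. The number of 2-balanced colorings of C_n using exactly the colors 1, …, ℓ with exactly α_t vertices of color t for each t equals the number of proper colorings of C_n of the same kind when α ≠ (1,1,…,1), and equals that number minus 2n when α = (1,1,…,1). Equivalently, X^2_{C_n} = X_{C_n} − 2n·M_{(1,1,…,1)}. -/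
section CycleAux

open Fin.CommRing

theorem fwdCount_eq {V : Type*} {G : SimpleGraph V} (r : V → V → Prop) [DecidableRel r] {u v : V}
    (c : G.Walk u v) :
    (c.darts.filter fun d => decide (r d.toProd.1 d.toProd.2)).length =
      ((Finset.range c.length).filter fun i => r (c.getVert i) (c.getVert (i+1))).card := by
  induction c with
  | nil => simp; rfl
  | @cons a b _ h p ih =>
    rw [SimpleGraph.Walk.darts_cons, SimpleGraph.Walk.length_cons, List.filter_cons,
      Finset.range_eq_Ico, Finset.card_filter, Finset.sum_Ico_eq_sum_range, 
      Nat.sub_zero, Finset.sum_range_succ']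
    rw [Finset.card_filter] at ih
    simp only [zero_add, SimpleGraph.Walk.getVert_cons_succ, SimpleGraph.Walk.getVert_zero]
    by_cases hr : r a b
    · rw [if_pos (by simpa using hr), if_pos hr, List.length_cons, ih]
    · rw [if_neg (by simpa using hr), if_neg hr, ih]; rfl

theorem cyc_step {m : ℕ} {v : Fin (m+3)} (c : (SimpleGraph.cycleGraph (m+3)).Walk v v)
    (hc : c.IsCycle) : ∃ s : Fin (m+3), (s = 1 ∨ s = -1) ∧
      ∀ i ≤ c.length, c.getVert i = v + i * s := by
  have adj : ∀ i < c.length, c.getVert (i+1) - c.getVert i = 1 ∨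
      c.getVert (i+1) - c.getVert i = -1 := by
    intro i hi
    have := c.adj_getVert_succ hi
    rw [SimpleGraph.cycleGraph_adj] at this
    rcases this with h | h
    · right; rw [← h]; ring
    · left; exact h
  have hl := hc.three_le_length
  refine ⟨c.getVert 1 - c.getVert 0, adj 0 (by omega), ?_⟩
  have key : ∀ i < c.length, c.getVert (i+1) - c.getVert i = c.getVert 1 - c.getVert 0 := by
    intro i
    induction i with
    | zero => intro _; rfl
    | succ i ih =>
      intro hi
      have h1 := ih (by omega)
      have hne := hc.getVert_sub_one_ne_getVert_add_one (i := i+1) (by omega)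
      simp only [Nat.add_sub_cancel] at hne
      rw [← h1]
      rcases adj i (by omega) with h | h <;> rcases adj (i+1) hi with h' | h'
      · rw [h, h']
      · exfalso; apply hne
        linear_combination -h - h'
      · exfalso; apply hne
        linear_combination -h - h'
      · rw [h, h']
  intro i
  induction i with
  | zero => intro _; simp
  | succ i ih =>
    intro hi
    have h1 := ih (by omega)
    have h2 := key i (by omega)
    push_cast
    linear_combination h1 + h2

theorem cyc_count {m : ℕ} {v : Fin (m+3)} (c : (SimpleGraph.cycleGraph (m+3)).Walk v v)
    (hc : c.IsCycle) : ∃ s : Fin (m+3), (s = 1 ∨ s = -1) ∧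
      ∀ r : Fin (m+3) → Fin (m+3) → Prop, fwdCount r c = Nat.card {i // r i (i + s)} := by
  obtain ⟨s, hs, h⟩ := cyc_step c hc
  have hss : s * s = 1 := by rcases hs with rfl | rfl <;> ring
  have hl := hc.three_le_length
  have hlen : c.length = m + 3 := by
    have h1 := h c.length le_rfl
    rw [SimpleGraph.Walk.getVert_length] at h1
    have h2 : ((c.length : ℕ) : Fin (m+3)) = 0 := by
      linear_combination s * (-h1) - c.length * hss
    rw [Fin.natCast_eq_zero] at h2
    have h3 : c.length ≤ m + 3 := by
      by_contra hcon
      have := hc.getVert_injOn' (x₁ := 0) (x₂ := m + 3) (by simp) (by simp; omega)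
        (by rw [h _ (by omega), h _ (by omega)]; simp)
      omega
    exact le_antisymm h3 (Nat.le_of_dvd (by omega) h2)
  refine ⟨s, hs, fun r => ?_⟩
  classical
  unfold fwdCount
  have := fwdCount_eq r c
  convert this using 1
  rw [Nat.card_eq_fintype_card, Fintype.card_subtype, hlen]
  symm
  apply Finset.card_bij (fun (i : ℕ) _ => v + (i : Fin (m+3)) * s)
  · intro i hi
    simp only [Finset.mem_filter, Finset.mem_range] at hi
    rw [h i (by omega), h (i+1) (by omega)] at hi
    simp only [Finset.mem_filter, Finset.mem_univ, true_and]
    convert hi.2 using 1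
    push_cast; ring
  · intro i hi j hj hij
    simp only [Finset.mem_filter, Finset.mem_range] at hi hj
    have : (i : Fin (m+3)) = j := by
      linear_combination s * hij + (j - i : Fin (m+3)) * hss
    have := congrArg Fin.val this
    rwa [Fin.val_natCast, Fin.val_natCast, Nat.mod_eq_of_lt hi.1, Nat.mod_eq_of_lt hj.1] at this
  · intro b hb
    simp only [Finset.mem_filter, Finset.mem_univ, true_and] at hb
    have e : v + (((s * (b - v)).val : ℕ) : Fin (m+3)) * s = b := by
      rw [Fin.cast_val_eq_self]
      linear_combination (b - v) * hss
    refine ⟨(s * (b - v)).val, ?_, e⟩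
    have hlt := (s * (b - v)).isLt
    simp only [Finset.mem_filter, Finset.mem_range]
    refine ⟨hlt, ?_⟩
    rw [h _ (by omega), h _ (by omega), e]
    convert hb using 1
    push_cast [Fin.cast_val_eq_self] at e ⊢
    linear_combination e

theorem balanced_iff {m : ℕ} (κ : Fin (m+3) → ℕ+) :
    KBalancedRel (SimpleGraph.cycleGraph (m+3)) (fun i j => κ i < κ j) 2 ↔
      2 ≤ Nat.card {i // κ i < κ (i+1)} ∧ 2 ≤ Nat.card {i // κ (i+1) < κ i} := by
  have e1 : Nat.card {i // κ i < κ (i + -1)} = Nat.card {i // κ (i+1) < κ i} := by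
    apply Nat.card_congr
    refine (Equiv.addRight (-1)).subtypeEquiv ?_
    intro a
    simp
  have e2 : Nat.card {i // κ (i + -1) < κ i} = Nat.card {i // κ i < κ (i+1)} := by
    apply Nat.card_congr
    refine (Equiv.addRight (-1)).subtypeEquiv ?_
    intro a
    simp
  constructor
  · intro h
    have h1 := h _ (SimpleGraph.cycleGraph.isCycle_cycle (n := m))
    obtain ⟨s, hs, hh⟩ := cyc_count _ (SimpleGraph.cycleGraph.isCycle_cycle (n := m))
    rw [hh, hh] at h1
    rcases hs with rfl | rfl
    · exact h1
    · rw [e1, e2] at h1; exact h1.symm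
  · intro h v c hc
    obtain ⟨s, hs, hh⟩ := cyc_count c hc
    rw [hh, hh]
    rcases hs with rfl | rfl
    · exact h
    · rw [e1, e2]; exact h.symm

theorem strict_of_card {m : ℕ} (κ : Fin (m+3) → ℕ+)
    (hp : IsProperColoring (SimpleGraph.cycleGraph (m+3)) κ)
    (h : ¬ 2 ≤ Nat.card {i // κ (i+1) < κ i}) :
    ∃ a, StrictMono fun i => κ (a + i) := by
  classical
  rw [Nat.card_eq_fintype_card, Fintype.card_subtype] at h
  have h1 : (Finset.univ.filter fun i => κ (i+1) < κ i).card ≤ 1 := by omega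
  obtain ⟨b, hb⟩ := Finset.card_le_one_iff_subset_singleton.mp h1
  refine ⟨b + 1, ?_⟩
  have key : ∀ j, j ≠ b → κ j < κ (j+1) := by
    intro j hj
    by_contra hcon
    have hne : κ j ≠ κ (j+1) := hp (by rw [SimpleGraph.cycleGraph_adj]; right; ring)
    have : j ∈ ({b} : Finset (Fin (m+3))) := hb (by
      simp only [Finset.mem_filter, Finset.mem_univ, true_and]
      exact lt_of_le_of_ne (not_lt.mp hcon) hne.symm)
    exact hj (by simpa using this)
  rw [Fin.strictMono_iff_lt_succ]
  intro i
  have := key (b + 1 + i.castSucc) (by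
    intro hh
    have h2 : i.castSucc + 1 = 0 := by linear_combination hh
    rw [Fin.coeSucc_eq_succ] at h2
    exact Fin.succ_ne_zero _ h2)
  rw [← Fin.coeSucc_eq_succ, ← add_assoc]
  exact this

theorem neg_proper {m : ℕ} {κ : Fin (m+3) → ℕ+}
    (hp : IsProperColoring (SimpleGraph.cycleGraph (m+3)) κ) :
    IsProperColoring (SimpleGraph.cycleGraph (m+3)) (fun i => κ (-i)) := by
  intro i j hij
  apply hp
  rw [SimpleGraph.cycleGraph_adj] at hij ⊢
  rcases hij with h | h
  · right; rw [← h]; ring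
  · left; rw [← h]; ring

/-- the monotone colorings -/
def monoCol (m : ℕ) (x : Bool × Fin (m+3)) (v : Fin (m+3)) : ℕ+ :=
  if x.1 then Nat.succPNat (v - x.2).val else Nat.succPNat (x.2 - v).val

theorem bad_strict {m : ℕ} (κ : Fin (m+3) → ℕ+)
    (hp : IsProperColoring (SimpleGraph.cycleGraph (m+3)) κ)
    (h : ¬ IsKBalancedColoring (SimpleGraph.cycleGraph (m+3)) 2 κ) :
    (∃ a, StrictMono fun i => κ (a + i)) ∨ (∃ a, StrictMono fun i => κ (a - i)) := by
  by_cases hD : 2 ≤ Nat.card {i // κ (i+1) < κ i}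
  · right
    have hU : ¬ 2 ≤ Nat.card {i // κ i < κ (i+1)} := by
      intro hU
      exact h ⟨hp, (balanced_iff κ).2 ⟨hU, hD⟩⟩
    have e : Nat.card {i // κ i < κ (i+1)} = Nat.card {i // κ (-(i+1)) < κ (-i)} := by
      apply Nat.card_congr
      refine ((Equiv.addRight 1).trans (Equiv.neg _)).subtypeEquiv ?_
      intro a
      have : -(-(a+1)+1) = a := by ring
      simp only [Equiv.trans_apply, Equiv.coe_addRight, Equiv.neg_apply, this, neg_neg]
    rw [e] at hU
    obtain ⟨a, ha⟩ := strict_of_card (fun i => κ (-i)) (neg_proper hp) hU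
    refine ⟨-a, ?_⟩
    convert ha using 3
    ring
  · left
    exact strict_of_card κ hp hD

theorem bad_inj {m : ℕ} (κ : Fin (m+3) → ℕ+)
    (hp : IsProperColoring (SimpleGraph.cycleGraph (m+3)) κ)
    (h : ¬ IsKBalancedColoring (SimpleGraph.cycleGraph (m+3)) 2 κ) :
    Function.Injective κ := by
  rcases bad_strict κ hp h with ⟨a, ha⟩ | ⟨a, ha⟩
  · intro x y hxy
    have := ha.injective (a₁ := x - a) (a₂ := y - a) (by simpa using hxy)
    simpa using this
  · intro x y hxy
    have := ha.injective (a₁ := a - x) (a₂ := a - y) (by simpa using hxy)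
    simpa using this

theorem mono_eq {m : ℕ} (f : Fin (m+3) → ℕ+) (hf : StrictMono f)
    (hb : ∀ v, (f v : ℕ) ≤ m + 3) (i) : f i = Nat.succPNat i.val := by
  have hs : StrictMono (fun i => (⟨(f i : ℕ) - 1, by
      have := hb i; have := (f i).pos; omega⟩ : Fin (m+3))) := by
    intro x y hxy
    have : (f x : ℕ) < f y := hf hxy
    have := (f x).pos
    simp only [Fin.mk_lt_mk]
    omega
  have := congrFun hs.eq_id i
  have := congrArg Fin.val this
  simp only [id] at this
  have := (f i).pos
  apply PNat.coe_injective
  simp only [Nat.succPNat_coe, Nat.succ_eq_add_one]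
  omega

theorem bad_mono {m : ℕ} (κ : Fin (m+3) → ℕ+)
    (hp : IsProperColoring (SimpleGraph.cycleGraph (m+3)) κ)
    (h : ¬ IsKBalancedColoring (SimpleGraph.cycleGraph (m+3)) 2 κ)
    (hb : ∀ v, (κ v : ℕ) ≤ m + 3) : ∃ x, monoCol m x = κ := by
  rcases bad_strict κ hp h with ⟨a, ha⟩ | ⟨a, ha⟩
  · refine ⟨(true, a), funext fun v => ?_⟩
    have := mono_eq _ ha (fun v => hb _) (v - a)
    simp only [add_sub_cancel] at this
    simp [monoCol, this]
  · refine ⟨(false, a), funext fun v => ?_⟩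
    have := mono_eq _ ha (fun v => hb _) (a - v)
    simp only [sub_sub_cancel] at this
    simp [monoCol, this]

theorem monoCol_inj_right {m : ℕ} (x) : Function.Injective (monoCol m x) := by
  intro u v h
  rcases x with ⟨_ | _, a⟩ <;> simp only [monoCol, Nat.succPNat_inj, if_true, Fin.val_inj,
    Bool.false_eq_true, if_false] at h
  · simpa using h
  · simpa using h

theorem monoCol_le {m : ℕ} (x) (v) : (monoCol m x v : ℕ) ≤ m + 3 := by
  unfold monoCol
  split <;> simp only [Nat.succPNat_coe] <;> omega

theorem monoCol_proper {m : ℕ} (x) :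
    IsProperColoring (SimpleGraph.cycleGraph (m+3)) (monoCol m x) := 
  fun _ _ hij he => hij.ne (monoCol_inj_right x he)

theorem val_lt_succ {m : ℕ} (w : Fin (m+3)) (h : (w + 1).val < w.val) : w = -1 := by
  by_contra hne
  have : w ≠ Fin.last _ := by
    intro hh
    apply hne
    rw [hh, eq_neg_iff_add_eq_zero]
    exact Fin.last_add_one _
  have h2 := Fin.val_add_one w
  rw [if_neg this] at h2
  change (w + 1).val = w.val + 1 at h2
  rw [h2] at h
  omega

theorem monoCol_bad {m : ℕ} (x) :
    ¬ IsKBalancedColoring (SimpleGraph.cycleGraph (m+3)) 2 (monoCol m x) := by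
  rintro ⟨-, h⟩
  rw [balanced_iff] at h
  rcases x with ⟨_ | _, a⟩
  · have h1 := h.1
    have : Subsingleton {i // monoCol m (false, a) i < monoCol m (false, a) (i+1)} := by
      constructor
      have key : ∀ i, monoCol m (false, a) i < monoCol m (false, a) (i+1) → i = a := by
        intro i hi
        simp only [monoCol, Bool.false_eq_true, if_false, Nat.succPNat_lt_succPNat, Fin.val_fin_lt] at hi
        have := val_lt_succ (a - (i+1)) (by
          have e : a - (i+1) + 1 = a - i := by ring
          rw [e]; exact hi)
        linear_combination -this
      rintro ⟨i, hi⟩ ⟨j, hj⟩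
      exact Subtype.ext ((key i hi).trans (key j hj).symm)
    have := Finite.card_le_one_iff_subsingleton.2 this
    omega
  · have h1 := h.2
    have : Subsingleton {i // monoCol m (true, a) (i+1) < monoCol m (true, a) i} := by
      constructor
      have key : ∀ i, monoCol m (true, a) (i+1) < monoCol m (true, a) i → i = a - 1 := by
        intro i hi
        simp only [monoCol, if_true, Nat.succPNat_lt_succPNat, Fin.val_fin_lt] at hi
        have := val_lt_succ (i - a) (by
          have e : i - a + 1 = i + 1 - a := by ring
          rw [e]; exact hi)
        linear_combination this
      rintro ⟨i, hi⟩ ⟨j, hj⟩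
      exact Subtype.ext ((key i hi).trans (key j hj).symm)
    have := Finite.card_le_one_iff_subsingleton.2 this
    omega

theorem two_ne {m : ℕ} : (1 : Fin (m+3)) ≠ -1 := by
  intro h
  have h2 : ((2 : ℕ) : Fin (m+3)) = 0 := by push_cast; linear_combination h
  rw [Fin.natCast_eq_zero] at h2
  have := Nat.le_of_dvd (by omega) h2
  omega

theorem monoCol_inj {m : ℕ} : Function.Injective (monoCol m) := by
  rintro ⟨s, a⟩ ⟨t, b⟩ h
  have h0 := congrFun h b
  have h1 := congrFun h (b + 1)
  rcases s with _ | _ <;> rcases t with _ | _ <;>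
    simp only [monoCol, Bool.false_eq_true, if_false, if_true, Nat.succPNat_inj, Fin.val_inj] at h0 h1
  · congr 1; linear_combination h0
  · exfalso; apply two_ne (m := m); linear_combination h0 - h1
  · exfalso; apply two_ne (m := m); linear_combination h1 - h0
  · congr 1; linear_combination -h0

end CycleAux

theorem content_bij {n : ℕ} (κ : Fin n → ℕ+)
    (h : ∀ t : Fin n, Nat.card {v : Fin n // (κ v : ℕ) = (t : ℕ) + 1} = 1) (v) :
    (κ v : ℕ) ≤ n := by
  have h1 : ∀ t : Fin n, ∃ v, (κ v : ℕ) = (t : ℕ) + 1 := by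
    intro t
    have : Nonempty {v : Fin n // (κ v : ℕ) = (t : ℕ) + 1} :=
      (Nat.card_pos_iff.1 (by rw [h t]; exact one_pos)).1
    exact ⟨this.some.1, this.some.2⟩
  choose g hg using h1
  have hinj : Function.Injective g := by
    intro s t hst
    have h1 := hg s
    rw [hst, hg t] at h1
    ext; omega
  obtain ⟨t, rfl⟩ := Finite.surjective_of_injective hinj v
  rw [hg]
  have := t.isLt
  omega

theorem content_of_inj {n : ℕ} (κ : Fin n → ℕ+) (hi : Function.Injective κ)
    (hb : ∀ v, (κ v : ℕ) ≤ n) (t : Fin n) :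
    Nat.card {v : Fin n // (κ v : ℕ) = (t : ℕ) + 1} = 1 := by
  have hinj : Function.Injective
      (fun v => (⟨(κ v : ℕ) - 1, by have := hb v; have := (κ v).pos; omega⟩ : Fin n)) := by
    intro x y hxy
    have := congrArg Fin.val hxy
    have h1 := (κ x).pos
    have h2 := (κ y).pos
    simp only at this
    apply hi
    apply PNat.coe_injective
    show (κ x : ℕ) = κ y
    omega
  obtain ⟨v, hv⟩ := Finite.surjective_of_injective hinj t
  have hv := congrArg Fin.val hv
  have h1 := (κ v).pos
  simp only at hv
  rw [Nat.card_eq_one_iff_unique]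
  refine ⟨⟨?_⟩, ⟨⟨v, by omega⟩⟩⟩
  rintro ⟨x, hx⟩ ⟨y, hy⟩
  exact Subtype.ext (hi (PNat.coe_injective (hx.trans hy.symm)))

/-- For `n ≥ 3` and a composition `α = (α_1,…,α_ℓ)` of `n`, the number of
2-balanced colorings of the cycle `C_n` using exactly the colors `1,…,ℓ` with `α_t` vertices
of color `t` equals the number of proper colorings of the same kind, minus `2n` when
`α = (1,1,…,1)`.  Equivalently `X²_{C_n} = X_{C_n} − 2n · M_{(1,…,1)}`. -/
theorem stmt7 (n : ℕ) (hn : 3 ≤ n) (ℓ : ℕ) (α : Fin ℓ → ℕ)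
    (hpos : ∀ t, 0 < α t) (hsum : ∑ t, α t = n) :
    (Nat.card {κ : Fin n → ℕ+ // IsKBalancedColoring (SimpleGraph.cycleGraph n) 2 κ ∧
        ∀ t : Fin ℓ, Nat.card {v : Fin n // (κ v : ℕ) = (t : ℕ) + 1} = α t} : ℤ) =
    (Nat.card {κ : Fin n → ℕ+ // IsProperColoring (SimpleGraph.cycleGraph n) κ ∧
        ∀ t : Fin ℓ, Nat.card {v : Fin n // (κ v : ℕ) = (t : ℕ) + 1} = α t} : ℤ) -
      (if ∀ t, α t = 1 then (2 * n : ℤ) else 0) := by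
  obtain ⟨m, rfl⟩ : ∃ m, n = m + 3 := ⟨n - 3, by omega⟩
  split_ifs with hα
  · obtain rfl : ℓ = m + 3 := by simpa [hα] using hsum
    simp only [hα]
    set P : Set (Fin (m+3) → ℕ+) := {κ | IsProperColoring (SimpleGraph.cycleGraph (m+3)) κ ∧
        ∀ t : Fin (m+3), Nat.card {v : Fin (m+3) // (κ v : ℕ) = (t : ℕ) + 1} = 1} with hP
    set B : Set (Fin (m+3) → ℕ+) :=
      {κ | IsKBalancedColoring (SimpleGraph.cycleGraph (m+3)) 2 κ ∧
        ∀ t : Fin (m+3), Nat.card {v : Fin (m+3) // (κ v : ℕ) = (t : ℕ) + 1} = 1} with hB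
    show ((Nat.card B : ℕ) : ℤ) = (Nat.card P : ℕ) - _
    have hfin : P.Finite := by
      apply Set.Finite.subset (Set.Finite.pi' (fun _ : Fin (m+3) =>
        Set.finite_Iic (Nat.succPNat (m+3))))
      intro κ hκ v
      have := content_bij κ hκ.2 v
      show (κ v : ℕ) ≤ (Nat.succPNat (m+3) : ℕ)
      rw [Nat.succPNat_coe]
      omega
    have hsub : B ⊆ P := fun κ hκ => ⟨hκ.1.1, hκ.2⟩
    have hdiff : P \ B = Set.range (monoCol m) := by
      ext κ
      constructor
      · rintro ⟨h1, h2⟩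
        exact bad_mono κ h1.1 (fun h => h2 ⟨h, h1.2⟩) (content_bij κ h1.2)
      · rintro ⟨x, rfl⟩
        exact ⟨⟨monoCol_proper x, content_of_inj _ (monoCol_inj_right x) (monoCol_le x)⟩,
          fun h => monoCol_bad x h.1⟩
    have hc := Set.ncard_sdiff_add_ncard_of_subset hsub hfin
    rw [hdiff, ← Nat.card_coe_set_eq (Set.range _), Nat.card_range_of_injective monoCol_inj]
      at hc
    rw [Nat.card_coe_set_eq, Nat.card_coe_set_eq, ← hc]
    simp
  · rw [sub_zero]
    congr 1
    apply Nat.card_congr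
    apply Equiv.subtypeEquivRight
    intro κ
    refine ⟨fun h => ⟨h.1.1, h.2⟩, fun h => ⟨?_, h.2⟩⟩
    by_contra hb
    apply hα
    intro t
    have hi := bad_inj κ h.1 hb
    have h1 : Nat.card {v : Fin (m+3) // (κ v : ℕ) = (t : ℕ) + 1} ≤ 1 := by
      rw [Finite.card_le_one_iff_subsingleton]
      constructor
      rintro ⟨x, hx⟩ ⟨y, hy⟩
      exact Subtype.ext (hi (PNat.coe_injective (hx.trans hy.symm)))
    have := hpos t
    have := h.2 t
    omega
end

section
/- Let C_n be the cycle graph on n ≥ 3 vertices, let k ≥ 1, and let α = (α_1, …, α_ℓ) be a composition of n. For any index 1 ≤ i < ℓ, the number of k-balanced colorings of C_n using exactly the colors 1, …, ℓ with exactly α_t vertices of color t for each t is unchanged when the parts α_i and α_{i+1} are swapped. Consequently this count depends only on the multiset of parts of α, i.e., the k-balanced chromatic quasisymmetric function X^k_{C_n} is a symmetric function for every k. -/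
/-- The number of `k`-balanced colorings of the cycle `C_n` using exactly the colors
`1, …, ℓ` with exactly `α t` vertices of color `t + 1` for each `t : Fin ℓ`. -/
noncomputable def cycleCount (n k ℓ : ℕ) (α : Fin ℓ → ℕ) : ℕ :=
  Nat.card {κ : Fin n → ℕ+ // IsKBalancedColoring (SimpleGraph.cycleGraph n) k κ ∧
    ∀ t : Fin ℓ, Nat.card {v : Fin n // (κ v : ℕ) = (t : ℕ) + 1} = α t}


section cyc
open SimpleGraph

lemma cyc_adj {m : ℕ} {u v : Fin (m + 3)} (h : (cycleGraph (m + 3)).Adj u v) :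
    v = u + 1 ∨ u = v + 1 := by
  rw [SimpleGraph.cycleGraph_eq_circulantGraph, circulantGraph_adj] at h
  simp only [Set.mem_singleton_iff, sub_eq_iff_eq_add] at h
  grind

lemma adj_cyc {m : ℕ} (u : Fin (m + 3)) : (cycleGraph (m + 3)).Adj u (u + 1) := by
  rw [SimpleGraph.cycleGraph_eq_circulantGraph, circulantGraph_adj]
  simp

lemma next_dart {V : Type*} [DecidableEq V] {G : SimpleGraph V} {w : V} (c : G.Walk w w)
    (hc : c.IsCycle) (d : G.Dart) (hd : d ∈ c.darts) :
    ∃ e ∈ c.darts, e.fst = d.snd ∧ e.snd ≠ d.fst := by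
  have hu : d.snd ∈ c.support := c.dart_snd_mem_support_of_mem_darts hd
  have hperm := (c.rotate_darts d.snd hu).perm
  have hc' : (c.rotate d.snd hu).IsCycle := (Walk.isCycle_rotate hu).2 hc
  generalize c.rotate d.snd hu = c' at hperm hc'
  cases c' with
  | nil => exact absurd rfl hc'.ne_nil
  | @cons _ x _ h p =>
    refine ⟨⟨(d.snd, x), h⟩, hperm.mem_iff.1 (by simp), rfl, ?_⟩
    intro (hx : x = d.fst)
    have hnd := hc.edges_nodup
    have h1 : (⟨(d.snd, x), h⟩ : G.Dart) ∈ c.darts := hperm.mem_iff.1 (by simp)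
    have h2 := List.inj_on_of_nodup_map (f := Dart.edge) hnd h1 hd
      (by subst hx; simp [Dart.edge, Sym2.eq_swap])
    have h3 := congrArg (fun e : G.Dart => e.fst) h2
    exact d.fst_ne_snd h3.symm

lemma fin_trans {m : ℕ} (v w : Fin (m + 3)) :
    ∃ j : ℕ, (Equiv.addRight (1 : Fin (m + 3)))^[j] v = w := by
  have : ∀ j : ℕ, ((Equiv.addRight (1 : Fin (m + 3)))^[j] v).val = (v.val + j) % (m + 3) := by
    intro j
    induction j with
    | zero => simp [Nat.mod_eq_of_lt v.isLt]
    | succ j ih =>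
      rw [Function.iterate_succ_apply', Equiv.coe_addRight, Fin.val_add]
      rw [Equiv.coe_addRight] at ih
      rw [ih]
      simp [Nat.add_assoc]
  refine ⟨w.val + (m + 3) - v.val, Fin.ext ?_⟩
  rw [this]
  have h1 := v.isLt
  have h2 := w.isLt
  rw [show v.val + (w.val + (m + 3) - v.val) = w.val + (m + 3) by omega, Nat.add_mod_right,
    Nat.mod_eq_of_lt h2]

lemma fin_iter_all {m : ℕ} (P : Fin (m + 3) → Prop) (v : Fin (m + 3)) (h0 : P v)
    (h : ∀ v, P v → P (v + 1)) (w : Fin (m + 3)) : P w := by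
  have : ∀ j : ℕ, P ((Equiv.addRight (1 : Fin (m + 3)))^[j] v) := by
    intro j
    induction j with
    | zero => simpa using h0
    | succ j ih => rw [Function.iterate_succ_apply']; exact h _ ih
  obtain ⟨j, rfl⟩ := fin_trans v w
  exact this j

lemma next_up {m : ℕ} {w : Fin (m + 3)} (c : (cycleGraph (m + 3)).Walk w w)
    (hc : c.IsCycle) (v : Fin (m + 3))
    (hd : (⟨(v, v + 1), adj_cyc v⟩ : (cycleGraph (m + 3)).Dart) ∈ c.darts) :
    (⟨(v + 1, v + 1 + 1), adj_cyc _⟩ : (cycleGraph (m + 3)).Dart) ∈ c.darts := by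
  obtain ⟨⟨⟨x, y⟩, hxy⟩, he, h1, h2⟩ := next_dart c hc _ hd
  simp only at h1 h2
  subst h1
  rcases cyc_adj hxy with h | h <;> dsimp only at h
  · subst h; exact he
  · exact absurd (add_right_cancel h).symm h2

lemma all_up {m : ℕ} {w : Fin (m + 3)} (c : (cycleGraph (m + 3)).Walk w w)
    (hc : c.IsCycle) (v : Fin (m + 3))
    (hd : (⟨(v, v + 1), adj_cyc v⟩ : (cycleGraph (m + 3)).Dart) ∈ c.darts)
    (u : Fin (m + 3)) :
    (⟨(u, u + 1), adj_cyc u⟩ : (cycleGraph (m + 3)).Dart) ∈ c.darts :=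
  fin_iter_all (fun u => (⟨(u, u + 1), adj_cyc u⟩ : (cycleGraph (m + 3)).Dart) ∈ c.darts) v hd
    (fun v hv => next_up c hc v hv) u

open Classical in
lemma fwd_up {m : ℕ} {w : Fin (m + 3)} (c : (cycleGraph (m + 3)).Walk w w)
    (hc : c.IsCycle) (v : Fin (m + 3))
    (hd : (⟨(v, v + 1), adj_cyc v⟩ : (cycleGraph (m + 3)).Dart) ∈ c.darts)
    (r : Fin (m + 3) → Fin (m + 3) → Prop) :
    fwdCount r c = (Finset.univ.filter fun u => r u (u + 1)).card := by
  have hall := all_up c hc v hd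
  have hnd : c.darts.Nodup := List.Nodup.of_map _ hc.edges_nodup
  have hdarts : ∀ d ∈ c.darts, d.snd = d.fst + 1 := by
    rintro ⟨⟨x, y⟩, hxy⟩ hd
    rcases cyc_adj hxy with h | h <;> dsimp only at h
    · exact h
    · exfalso
      have h2 := List.inj_on_of_nodup_map (f := Dart.edge) hc.edges_nodup (hall y) hd
        (by subst h; simp [Dart.edge, Sym2.eq_swap])
      have h3 := congrArg (fun e => e.fst) h2
      exact hxy.ne h3.symm
  unfold fwdCount
  rw [← List.toFinset_card_of_nodup (hnd.filter _)]
  refine Finset.card_bij (fun d _ => d.fst) ?_ ?_ ?_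
  · intro d hd
    simp only [List.mem_toFinset, List.mem_filter, decide_eq_true_eq] at hd
    simp only [Finset.mem_filter, Finset.mem_univ, true_and]
    rw [← hdarts d hd.1]; exact hd.2
  · intro d hd e he h
    simp only [List.mem_toFinset, List.mem_filter] at hd he
    apply Dart.ext
    apply Prod.ext h
    have a1 := hdarts d hd.1
    have a2 := hdarts e he.1
    exact a1.trans ((congrArg (· + 1) h).trans a2.symm)
  · intro u hu
    simp only [Finset.mem_filter, Finset.mem_univ, true_and] at hu
    refine ⟨⟨(u, u + 1), adj_cyc u⟩, ?_, rfl⟩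
    simp only [List.mem_toFinset, List.mem_filter, decide_eq_true_eq]
    exact ⟨hall u, hu⟩

lemma fwd_reverse {V : Type*} {G : SimpleGraph V} {w : V} (r : V → V → Prop) (c : G.Walk w w) :
    fwdCount r c.reverse = fwdCount (fun i j => r j i) c := by
  classical
  unfold fwdCount
  rw [Walk.darts_reverse, List.filter_reverse, List.length_reverse, List.filter_map,
    List.length_map]
  rfl

open Classical in
lemma fwd_cases {m : ℕ} {w : Fin (m + 3)} (c : (cycleGraph (m + 3)).Walk w w)
    (hc : c.IsCycle) :
    (∀ r : Fin (m + 3) → Fin (m + 3) → Prop,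
      fwdCount r c = (Finset.univ.filter fun u => r u (u + 1)).card) ∨
    (∀ r : Fin (m + 3) → Fin (m + 3) → Prop,
      fwdCount r c = (Finset.univ.filter fun u => r (u + 1) u).card) := by
  have : ∃ d, d ∈ c.darts := by
    cases c with
    | nil => exact absurd rfl hc.ne_nil
    | cons h p => exact ⟨_, by simp; left; rfl⟩
  obtain ⟨⟨⟨x, y⟩, hxy⟩, hd⟩ := this
  rcases cyc_adj hxy with h | h <;> dsimp only at h
  · left
    subst h
    exact fwd_up c hc x hd
  · right
    subst h
    intro r
    have := fwd_up c.reverse hc.reverse y (by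
      rw [Walk.darts_reverse, List.mem_reverse, List.mem_map]
      exact ⟨_, hd, rfl⟩) (fun i j => r j i)
    rw [fwd_reverse] at this
    exact this

open Classical in
lemma kbal_of {m k : ℕ} (κ κ' : Fin (m + 3) → ℕ+)
    (h1 : (Finset.univ.filter fun u => κ' u < κ' (u + 1)).card =
      (Finset.univ.filter fun u => κ u < κ (u + 1)).card)
    (h2 : (Finset.univ.filter fun u => κ' (u + 1) < κ' u).card =
      (Finset.univ.filter fun u => κ (u + 1) < κ u).card)
    (h : KBalancedRel (cycleGraph (m + 3)) (fun i j => κ i < κ j) k) :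
    KBalancedRel (cycleGraph (m + 3)) (fun i j => κ' i < κ' j) k := by
  intro v c hc
  have := h c hc
  rcases fwd_cases c hc with h | h
  · simp only [h] at this ⊢
    constructor
    · convert this.1 using 1; convert h1
    · convert this.2 using 1; convert h2
  · simp only [h] at this ⊢
    constructor
    · convert this.1 using 1; convert h2
    · convert this.2 using 1; convert h1

end cyc

section core
variable {V : Type*}

open Classical in
noncomputable def rdist (f : V → V) (A : V → Prop) (v : V) : ℕ :=
  if h : ∃ j, ¬ A (f^[j] v) then Nat.find h else 0

lemma rdist_step (f : V → V) (A : V → Prop) (v : V) (hA : A v) (h : ∃ j, ¬ A (f^[j] v)) :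
    rdist f A v = rdist f A (f v) + 1 := by
  classical
  have h2 : ∃ j, ¬ A (f^[j] (f v)) := by
    obtain ⟨j, hj⟩ := h
    cases j with
    | zero => exact absurd hA hj
    | succ j => exact ⟨j, by simpa using hj⟩
  have e1 : rdist f A v = Nat.find h := by unfold rdist; rw [dif_pos h]
  have e2 : rdist f A (f v) = Nat.find h2 := by unfold rdist; rw [dif_pos h2]
  rw [e1, e2]
  have := Nat.find_comp_succ h (by simpa using h2) (by simpa using hA)
  simpa using this

lemma rdist_zero (f : V → V) (A : V → Prop) (v : V) (hA : ¬ A v) :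
    rdist f A v = 0 := by
  classical
  have h : ∃ j, ¬ A (f^[j] v) := ⟨0, hA⟩
  unfold rdist
  rw [dif_pos h, Nat.find_eq_zero]
  exact hA

/-- the set of flipped vertices -/
def flipSet (s : Equiv.Perm V) (A : V → Prop) (v : V) : Prop :=
  (∃ w, ¬ A w) ∧ Even (rdist s A v + rdist s.symm A v)

open Classical in
noncomputable def flipCol (s : Equiv.Perm V) (a b : ℕ+) (κ : V → ℕ+) (v : V) : ℕ+ :=
  if flipSet s (fun w => κ w = a ∨ κ w = b) v then Equiv.swap a b (κ v) else κ v

lemma swap_mem (a b x : ℕ+) : (Equiv.swap a b x = a ∨ Equiv.swap a b x = b) ↔ (x = a ∨ x = b) := by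
  rw [Equiv.swap_apply_eq_iff, Equiv.swap_apply_eq_iff]; simp [or_comm]

lemma flipCol_mem (s : Equiv.Perm V) (a b : ℕ+) (κ : V → ℕ+) (v : V) :
    (flipCol s a b κ v = a ∨ flipCol s a b κ v = b) ↔ (κ v = a ∨ κ v = b) := by
  unfold flipCol
  split_ifs
  · exact swap_mem a b _
  · rfl

lemma flipCol_flipCol (s : Equiv.Perm V) (a b : ℕ+) (κ : V → ℕ+) :
    flipCol s a b (flipCol s a b κ) = κ := by
  funext v
  have : (fun w => flipCol s a b κ w = a ∨ flipCol s a b κ w = b)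
      = (fun w => κ w = a ∨ κ w = b) := by
    funext w; exact propext (flipCol_mem s a b κ w)
  rw [flipCol, this]
  unfold flipCol
  split_ifs <;> simp

variable (s : Equiv.Perm V) (hs : ∀ v w : V, ∃ j : ℕ, s^[j] v = w)

include hs in
lemma step_fwd (A : V → Prop) (hne : ∃ w, ¬ A w) (v : V) (hA : A v) :
    rdist s A v = rdist s A (s v) + 1 := by
  apply rdist_step _ _ _ hA
  obtain ⟨w, hw⟩ := hne
  obtain ⟨j, hj⟩ := hs v w
  exact ⟨j, by rwa [hj]⟩

include hs in
lemma step_bwd (A : V → Prop) (hne : ∃ w, ¬ A w) (v : V) (hA : A v) :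
    rdist s.symm A v = rdist s.symm A (s.symm v) + 1 := by
  apply rdist_step _ _ _ hA
  obtain ⟨w, hw⟩ := hne
  obtain ⟨j, hj⟩ := hs w v
  refine ⟨j, ?_⟩
  have : Function.LeftInverse (s.symm^[j]) (s^[j]) := Function.LeftInverse.iterate s.left_inv j
  rw [← hj, this w]
  exact hw

open Classical in
/-- the pairing of neighbours inside runs -/
noncomputable def gmap (A : V → Prop) (v : V) : V :=
  if Even (rdist s.symm A v) then s.symm v else s v

include hs in
/-- pairing on even runs -/
lemma gmap_vert (A : V → Prop) (hne : ∃ w, ¬ A w) (v : V) (hA : A v) (hF : ¬ flipSet s A v) :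
    A (gmap s A v) ∧ ¬ flipSet s A (gmap s A v) ∧ gmap s A (gmap s A v) = v := by
  have hq := step_fwd s hs A hne v hA
  have hp := step_bwd s hs A hne v hA
  have hF' : ¬ Even (rdist s A v + rdist s.symm A v) := fun h => hF ⟨hne, h⟩
  by_cases hev : Even (rdist s.symm A v)
  · have hg : gmap s A v = s.symm v := by simp [gmap, hev]
    have hA' : A (s.symm v) := by
      by_contra hc
      rw [rdist_zero _ _ _ hc] at hp
      rw [hp] at hev; simp at hev
    have hq' := step_fwd s hs A hne _ hA'
    simp only [Equiv.apply_symm_apply] at hq'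
    have hod : ¬ Even (rdist s.symm A (s.symm v)) := by
      rw [hp] at hev; grind
    refine ⟨by rwa [hg], ?_, ?_⟩
    · rw [hg]; rintro ⟨-, h⟩; grind
    · rw [hg]; simp [gmap, hod]
  · have hg : gmap s A v = s v := by simp [gmap, hev]
    have hA' : A (s v) := by
      by_contra hc
      rw [rdist_zero _ _ _ hc] at hq
      grind
    have hp' := step_bwd s hs A hne _ hA'
    simp only [Equiv.symm_apply_apply] at hp'
    have hod : Even (rdist s.symm A (s v)) := by grind
    refine ⟨by rwa [hg], ?_, ?_⟩
    · rw [hg]; rintro ⟨-, h⟩; grind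
    · rw [hg]; simp [gmap, hod]

include hs in
lemma flipSet_succ (A : V → Prop) (v : V) (hA : A v) (hA' : A (s v)) :
    flipSet s A (s v) ↔ flipSet s A v := by
  unfold flipSet
  refine and_congr_right fun hne => ?_
  have hq := step_fwd s hs A hne v hA
  have hp := step_bwd s hs A hne _ hA'
  simp only [Equiv.symm_apply_apply] at hp
  rw [hq, hp]
  grind

include hs in
/-- pairing of edges on odd runs -/
lemma gmap_edge (A : V → Prop) (v : V) (hA : A v) (hA1 : A (s v)) (hF : flipSet s A v) :
    A (gmap s A v) ∧ A (s (gmap s A v)) ∧ flipSet s A (gmap s A v) ∧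
      gmap s A (gmap s A v) = v := by
  have hne := hF.1
  have hF' := hF.2
  have hq := step_fwd s hs A hne v hA
  have hp := step_bwd s hs A hne v hA
  have hq1 := step_fwd s hs A hne _ hA1
  by_cases hev : Even (rdist s.symm A v)
  · have hg : gmap s A v = s.symm v := by simp [gmap, hev]
    have hA' : A (s.symm v) := by
      by_contra hc
      rw [rdist_zero _ _ _ hc] at hp
      rw [hp] at hev; simp at hev
    have hod : ¬ Even (rdist s.symm A (s.symm v)) := by
      rw [hp] at hev; grind
    refine ⟨by rwa [hg], by rw [hg]; simpa using hA, ?_, ?_⟩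
    · rw [hg, ← flipSet_succ s hs A _ hA' (by simpa using hA)]; simpa using hF
    · rw [hg]; simp [gmap, hod]
  · have hg : gmap s A v = s v := by simp [gmap, hev]
    have hA' : A (s (s v)) := by
      by_contra hc
      rw [rdist_zero _ _ _ hc] at hq1
      grind
    have hp' := step_bwd s hs A hne _ hA1
    simp only [Equiv.symm_apply_apply] at hp'
    have hod : Even (rdist s.symm A (s v)) := by grind
    refine ⟨by rwa [hg], by rwa [hg], ?_, ?_⟩
    · rw [hg, flipSet_succ s hs A _ hA hA1]; exact hF
    · rw [hg]; simp [gmap, hod]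

lemma gmap_cases (A : V → Prop) (v : V) : gmap s A v = s.symm v ∨ gmap s A v = s v := by
  unfold gmap; split_ifs <;> simp


open Classical in
include hs in
lemma count_unflipped [Fintype V] (a b : ℕ+) (κ : V → ℕ+) (hprop : ∀ v, κ v ≠ κ (s v)) :
    (Finset.univ.filter fun v => ¬ flipSet s (fun w => κ w = a ∨ κ w = b) v ∧ κ v = a).card =
    (Finset.univ.filter fun v => ¬ flipSet s (fun w => κ w = a ∨ κ w = b) v ∧ κ v = b).card := by
  set A : V → Prop := fun w => κ w = a ∨ κ w = b with hAdef
  by_cases hne : ∃ w, ¬ A w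
  · have key : ∀ v, A v → ¬ flipSet s A v → (κ (gmap s A v) ≠ κ v) ∧
        (κ (gmap s A v) = a ∨ κ (gmap s A v) = b) ∧ ¬ flipSet s A (gmap s A v) ∧
        gmap s A (gmap s A v) = v := by
      intro v hA hF
      obtain ⟨h1, h2, h3⟩ := gmap_vert s hs A hne v hA hF
      refine ⟨?_, h1, h2, h3⟩
      rcases gmap_cases s A v with h | h
      · rw [h]; simpa using hprop (s.symm v)
      · rw [h]; exact (hprop v).symm
    refine Finset.card_nbij' (gmap s A) (gmap s A) ?_ ?_ ?_ ?_
    · intro v hv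
      simp only [Finset.coe_filter, Finset.mem_univ, true_and, Set.mem_ofPred_eq] at hv ⊢
      have := key v (Or.inl hv.2) hv.1
      grind
    · intro v hv
      simp only [Finset.coe_filter, Finset.mem_univ, true_and, Set.mem_ofPred_eq] at hv ⊢
      have := key v (Or.inr hv.2) hv.1
      grind
    · intro v hv
      simp only [Finset.coe_filter, Finset.mem_univ, true_and, Set.mem_ofPred_eq] at hv ⊢
      exact (key v (Or.inl hv.2) hv.1).2.2.2
    · intro v hv
      simp only [Finset.coe_filter, Finset.mem_univ, true_and, Set.mem_ofPred_eq] at hv ⊢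
      exact (key v (Or.inr hv.2) hv.1).2.2.2
  · have hF : ∀ v, ¬ flipSet s A v := fun v h => hne h.1
    push Not at hne
    have hA : ∀ v, κ v = a ∨ κ v = b := hne
    simp only [hF, not_false_eq_true, true_and]
    refine Finset.card_nbij' s s.symm ?_ ?_ ?_ ?_
    · intro v hv
      simp only [Finset.coe_filter, Finset.mem_univ, true_and, Set.mem_ofPred_eq] at hv ⊢
      have := hprop v
      have := hA (s v)
      grind
    · intro v hv
      simp only [Finset.coe_filter, Finset.mem_univ, true_and, Set.mem_ofPred_eq] at hv ⊢
      have := hprop (s.symm v)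
      rw [Equiv.apply_symm_apply] at this
      have := hA (s.symm v)
      grind
    · intro v hv; simp
    · intro v hv; simp

open Classical in
include hs in
lemma flipCol_count [Fintype V] (a b : ℕ+) (κ : V → ℕ+) (hprop : ∀ v, κ v ≠ κ (s v)) (x : ℕ+) :
    (Finset.univ.filter fun v => flipCol s a b κ v = x).card =
    (Finset.univ.filter fun v => κ v = Equiv.swap a b x).card := by
  have hc := count_unflipped s hs a b κ hprop
  set F := flipSet s (fun w => κ w = a ∨ κ w = b) with hF
  have e1 : ∀ (P : V → Prop) [DecidablePred P], (Finset.univ.filter P).card =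
      (Finset.univ.filter fun v => F v ∧ P v).card + (Finset.univ.filter fun v => ¬ F v ∧ P v).card := by
    intro P _
    rw [← Finset.card_filter_add_card_filter_not (s := Finset.univ.filter P) F,
      Finset.filter_filter, Finset.filter_filter]
    simp only [and_comm]
  rw [e1, e1 (fun v => κ v = _)]
  congr 1
  · congr 1
    ext v
    simp only [Finset.mem_filter, Finset.mem_univ, true_and]
    refine and_congr_right fun h => ?_
    have : flipCol s a b κ v = Equiv.swap a b (κ v) := by unfold flipCol; exact if_pos h
    rw [this, Equiv.swap_apply_eq_iff]
  · have : ∀ v, (¬ F v ∧ flipCol s a b κ v = x) ↔ (¬ F v ∧ κ v = x) := by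
      intro v
      refine and_congr_right fun h => ?_
      have : flipCol s a b κ v = κ v := by unfold flipCol; exact if_neg h
      rw [this]
    simp only [this]
    by_cases hxa : x = a
    · subst hxa; simpa using hc
    by_cases hxb : x = b
    · subst hxb; simpa using hc.symm
    rw [Equiv.swap_apply_of_ne_of_ne hxa hxb]

include hs in
lemma flipCol_proper (a b : ℕ+) (κ : V → ℕ+) (hprop : ∀ v, κ v ≠ κ (s v)) (v : V) :
    flipCol s a b κ v ≠ flipCol s a b κ (s v) := by
  intro h
  have h1 := flipCol_mem s a b κ v
  have h2 := flipCol_mem s a b κ (s v)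
  have h3 : (κ v = a ∨ κ v = b) ↔ (κ (s v) = a ∨ κ (s v) = b) := by rw [← h1, ← h2, h]
  by_cases hA : κ v = a ∨ κ v = b
  · have := flipSet_succ s hs (fun w => κ w = a ∨ κ w = b) v hA (h3.1 hA)
    unfold flipCol at h
    by_cases hF : flipSet s (fun w => κ w = a ∨ κ w = b) v
    · rw [if_pos hF, if_pos (this.2 hF)] at h
      exact hprop v ((Equiv.swap a b).injective h)
    · rw [if_neg hF, if_neg (fun h => hF (this.1 h))] at h
      exact hprop v h
  · have hA' : ¬ (κ (s v) = a ∨ κ (s v) = b) := fun h => hA (h3.2 h)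
    push Not at hA hA'
    unfold flipCol at h
    rw [Equiv.swap_apply_of_ne_of_ne hA.1 hA.2, Equiv.swap_apply_of_ne_of_ne hA'.1 hA'.2] at h
    simp only [ite_self] at h
    exact hprop v h

lemma lt_flip_iff (a b x y : ℕ+) (hb : b = a + 1)
    (hx : x = a ∨ x = b) (hy : ¬ (y = a ∨ y = b)) :
    (Equiv.swap a b x < y ↔ x < y) ∧ (y < Equiv.swap a b x ↔ y < x) := by
  have hb' : (b : ℕ) = a + 1 := by rw [hb]; rfl
  push Not at hy
  have h1 : (y : ℕ) ≠ a := fun h => hy.1 (PNat.eq h)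
  have h2 : (y : ℕ) ≠ b := fun h => hy.2 (PNat.eq h)
  rcases hx with rfl | rfl
  · rw [Equiv.swap_apply_left]; simp only [← PNat.coe_lt_coe]; omega
  · rw [Equiv.swap_apply_right]; simp only [← PNat.coe_lt_coe]; omega

open Classical in
include hs in
lemma flipCol_asc [Fintype V] (a b : ℕ+) (hb : b = a + 1) (κ : V → ℕ+) (hprop : ∀ v, κ v ≠ κ (s v)) :
    (Finset.univ.filter fun v => flipCol s a b κ v < flipCol s a b κ (s v)).card =
    (Finset.univ.filter fun v => κ v < κ (s v)).card := by
  set A : V → Prop := fun w => κ w = a ∨ κ w = b with hAdef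
  have hab : a < b := by rw [hb]; exact PNat.lt_add_right a 1
  set E : V → Prop := fun v => A v ∧ A (s v) ∧ flipSet s A v with hE
  have e1 : ∀ (P : V → Prop) [DecidablePred P], (Finset.univ.filter P).card =
      (Finset.univ.filter fun v => E v ∧ P v).card + (Finset.univ.filter fun v => ¬ E v ∧ P v).card := by
    intro P _
    rw [← Finset.card_filter_add_card_filter_not (s := Finset.univ.filter P) E,
      Finset.filter_filter, Finset.filter_filter]
    simp only [and_comm]
  have hpos : ∀ v, flipSet s A v → flipCol s a b κ v = Equiv.swap a b (κ v) := by
    intro v h; unfold flipCol; exact if_pos h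
  have hneg : ∀ v, ¬ flipSet s A v → flipCol s a b κ v = κ v := by
    intro v h; unfold flipCol; exact if_neg h
  have hnA : ∀ v, ¬ A v → flipCol s a b κ v = κ v := by
    intro v h
    have h' : ¬ (κ v = a ∨ κ v = b) := h
    push Not at h'
    unfold flipCol; rw [Equiv.swap_apply_of_ne_of_ne h'.1 h'.2, ite_self]
  rw [e1, e1 (fun v => κ v < _)]
  congr 1
  · have key : ∀ v, E v → E (gmap s A v) ∧ gmap s A (gmap s A v) = v ∧
        (κ (gmap s A v) < κ (s (gmap s A v)) ↔ κ (s v) < κ v) := by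
      rintro v ⟨h1, h2, h3⟩
      obtain ⟨k1, k2, k3, k4⟩ := gmap_edge s hs A v h1 h2 h3
      refine ⟨⟨k1, k2, k3⟩, k4, ?_⟩
      have p1 := hprop v
      have p2 := hprop (gmap s A v)
      have h1' : κ v = a ∨ κ v = b := h1
      have h2' : κ (s v) = a ∨ κ (s v) = b := h2
      have k1' : κ (gmap s A v) = a ∨ κ (gmap s A v) = b := k1
      have k2' : κ (s (gmap s A v)) = a ∨ κ (s (gmap s A v)) = b := k2
      rcases gmap_cases s A v with h | h
      · rw [h] at p2 k1' k2' ⊢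
        rw [Equiv.apply_symm_apply] at *
        grind
      · rw [h] at p2 k1' k2' ⊢
        grind
    have flipE : ∀ v, (E v ∧ flipCol s a b κ v < flipCol s a b κ (s v)) ↔
        (E v ∧ κ (s v) < κ v) := by
      intro v
      refine and_congr_right fun ⟨h1, h2, h3⟩ => ?_
      have h1' : κ v = a ∨ κ v = b := h1
      have h2' : κ (s v) = a ∨ κ (s v) = b := h2
      have p1 := hprop v
      rw [hpos v h3, hpos (s v) ((flipSet_succ s hs A v h1 h2).2 h3)]
      rcases h1' with h | h <;> rcases h2' with h' | h' <;> rw [h, h'] at * <;>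
        simp_all
    simp only [flipE]
    refine Finset.card_nbij' (gmap s A) (gmap s A) ?_ ?_ ?_ ?_
    · intro v hv
      simp only [Finset.coe_filter, Finset.mem_univ, true_and, Set.mem_ofPred_eq] at hv ⊢
      exact ⟨(key v hv.1).1, (key v hv.1).2.2.2 hv.2⟩
    · intro v hv
      simp only [Finset.coe_filter, Finset.mem_univ, true_and, Set.mem_ofPred_eq] at hv ⊢
      obtain ⟨k1, k2, k3⟩ := key v hv.1
      have := (key _ k1).2.2
      rw [k2] at this
      exact ⟨k1, this.1 hv.2⟩
    · intro v hv
      simp only [Finset.coe_filter, Finset.mem_univ, true_and, Set.mem_ofPred_eq] at hv ⊢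
      exact (key v hv.1).2.1
    · intro v hv
      simp only [Finset.coe_filter, Finset.mem_univ, true_and, Set.mem_ofPred_eq] at hv ⊢
      exact (key v hv.1).2.1
  · congr 1
    ext v
    simp only [Finset.mem_filter, Finset.mem_univ, true_and]
    refine and_congr_right fun h => ?_
    by_cases h1 : A v <;> by_cases h2 : A (s v)
    · have h3 : ¬ flipSet s A v := fun h3 => h ⟨h1, h2, h3⟩
      rw [hneg v h3, hneg (s v) (fun h => h3 ((flipSet_succ s hs A v h1 h2).1 h))]
    · rw [hnA _ h2]
      by_cases h3 : flipSet s A v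
      · rw [hpos v h3]; exact (lt_flip_iff a b _ _ hb h1 h2).1
      · rw [hneg v h3]
    · rw [hnA _ h1]
      by_cases h3 : flipSet s A (s v)
      · rw [hpos _ h3]; exact (lt_flip_iff a b _ _ hb h2 h1).2
      · rw [hneg _ h3]
    · rw [hnA _ h1, hnA _ h2]

end core

section final
open SimpleGraph

open Classical in
lemma desc_of_asc {m : ℕ} (κ : Fin (m + 3) → ℕ+) (h : ∀ v, κ v ≠ κ (v + 1)) :
    (Finset.univ.filter fun u => κ u < κ (u + 1)).card +
      (Finset.univ.filter fun u => κ (u + 1) < κ u).card = m + 3 := by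
  have h1 := Finset.card_filter_add_card_filter_not (s := (Finset.univ : Finset (Fin (m + 3))))
    (fun u => κ u < κ (u + 1))
  rw [Finset.card_univ, Fintype.card_fin] at h1
  refine Eq.trans ?_ h1
  congr 2
  ext u
  simp only [Finset.mem_filter, Finset.mem_univ, true_and, not_lt]
  exact ⟨le_of_lt, fun h' => lt_of_le_of_ne h' (h u).symm⟩

lemma flip_bal {m k : ℕ} (a b : ℕ+) (hb : b = a + 1) (κ : Fin (m + 3) → ℕ+)
    (h : IsKBalancedColoring (cycleGraph (m + 3)) k κ) :
    IsKBalancedColoring (cycleGraph (m + 3)) k (flipCol (Equiv.addRight 1) a b κ) := by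
  have hprop : ∀ v, κ v ≠ κ (Equiv.addRight 1 v) := fun v => h.1 (adj_cyc v)
  have hp := flipCol_proper (Equiv.addRight 1) fin_trans a b κ hprop
  have hasc : (Finset.univ.filter fun u => flipCol (Equiv.addRight 1) a b κ u <
      flipCol (Equiv.addRight 1) a b κ (u + 1)).card =
      (Finset.univ.filter fun u => κ u < κ (u + 1)).card :=
    flipCol_asc (Equiv.addRight 1) fin_trans a b hb κ hprop
  have d1 := desc_of_asc κ hprop
  have d2 := desc_of_asc _ hp
  simp only [Equiv.coe_addRight] at hp d2
  refine ⟨?_, ?_⟩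
  · intro i j hij
    rcases cyc_adj hij with rfl | rfl
    · exact hp i
    · exact (hp j).symm
  · exact kbal_of κ _ hasc (by omega) h.2

lemma flip_cnt {m : ℕ} (a b : ℕ+) (κ : Fin (m + 3) → ℕ+)
    (h : IsProperColoring (cycleGraph (m + 3)) κ) (x : ℕ+) :
    Nat.card {v // flipCol (Equiv.addRight 1) a b κ v = x} =
      Nat.card {v // κ v = Equiv.swap a b x} := by
  classical
  have hprop : ∀ v, κ v ≠ κ (Equiv.addRight 1 v) := fun v => h (adj_cyc v)
  have := flipCol_count (Equiv.addRight 1) fin_trans a b κ hprop x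
  rw [Nat.card_eq_fintype_card, Nat.card_eq_fintype_card, Fintype.card_subtype,
    Fintype.card_subtype]
  convert this

lemma flip_pred {m k ℓ : ℕ} (α : Fin ℓ → ℕ) (i : ℕ) (h : i + 1 < ℓ) (κ : Fin (m + 3) → ℕ+)
    (hκ : IsKBalancedColoring (cycleGraph (m + 3)) k κ ∧
      ∀ t : Fin ℓ, Nat.card {v : Fin (m + 3) // (κ v : ℕ) = (t : ℕ) + 1} = α t) :
    IsKBalancedColoring (cycleGraph (m + 3)) k
        (flipCol (Equiv.addRight 1) i.succPNat (i + 1).succPNat κ) ∧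
      ∀ t : Fin ℓ, Nat.card {v : Fin (m + 3) //
        (flipCol (Equiv.addRight 1) i.succPNat (i + 1).succPNat κ v : ℕ) = (t : ℕ) + 1} =
        (α ∘ Equiv.swap ⟨i, Nat.lt_of_succ_lt h⟩ ⟨i + 1, h⟩) t := by
  refine ⟨flip_bal _ _ rfl κ hκ.1, fun t => ?_⟩
  have key : ∀ (f : Fin (m + 3) → ℕ+) (j : ℕ),
      Nat.card {v // (f v : ℕ) = j + 1} = Nat.card {v // f v = j.succPNat} := by
    intro f j
    have : ∀ v, ((f v : ℕ) = j + 1) ↔ f v = j.succPNat := fun v =>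
      ⟨fun h => PNat.eq h, fun h => by rw [h]; rfl⟩
    simp only [this]
  rw [key, flip_cnt _ _ κ hκ.1.1, Function.comp_apply, ← hκ.2, key]
  have : Equiv.swap i.succPNat (i + 1).succPNat (t : ℕ).succPNat =
      ((Equiv.swap (⟨i, Nat.lt_of_succ_lt h⟩ : Fin ℓ) ⟨i + 1, h⟩ t : Fin ℓ) : ℕ).succPNat := by
    simp only [Equiv.swap_apply_def, Nat.succPNat_inj, Fin.ext_iff]
    split_ifs <;> rfl
  rw [this]

lemma swap_inv {m k ℓ : ℕ} (α : Fin ℓ → ℕ) (i : ℕ) (h : i + 1 < ℓ) :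
    cycleCount (m + 3) k ℓ α = cycleCount (m + 3) k ℓ
      (α ∘ Equiv.swap ⟨i, Nat.lt_of_succ_lt h⟩ ⟨i + 1, h⟩) := by
  unfold cycleCount
  refine Nat.card_congr ⟨fun κ => ⟨_, flip_pred α i h κ.1 κ.2⟩,
    fun κ => ⟨flipCol (Equiv.addRight 1) i.succPNat (i + 1).succPNat κ.1, ?_⟩, ?_, ?_⟩
  · have := flip_pred _ i h κ.1 κ.2
    have e : (α ∘ Equiv.swap (⟨i, Nat.lt_of_succ_lt h⟩ : Fin ℓ) ⟨i + 1, h⟩) ∘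
        Equiv.swap ⟨i, Nat.lt_of_succ_lt h⟩ ⟨i + 1, h⟩ = α := by
      funext t; simp
    rwa [e] at this
  · intro κ; exact Subtype.ext (flipCol_flipCol _ _ _ _)
  · intro κ; exact Subtype.ext (flipCol_flipCol _ _ _ _)

lemma perm_inv {m k ℓ : ℕ} (σ : Equiv.Perm (Fin ℓ)) (α : Fin ℓ → ℕ) :
    cycleCount (m + 3) k ℓ α = cycleCount (m + 3) k ℓ (α ∘ σ) := by
  cases ℓ with
  | zero => congr 1; funext t; exact t.elim0
  | succ l =>
    have hσ : σ ∈ Submonoid.closure (Set.range fun i : Fin l ↦ Equiv.swap i.castSucc i.succ) := by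
      rw [Equiv.Perm.mclosure_swap_castSucc_succ]; trivial
    induction hσ using Submonoid.closure_induction generalizing α with
    | mem x hx =>
      obtain ⟨i, rfl⟩ := hx
      exact swap_inv α i.val (by omega)
    | one => rfl
    | mul x y _ _ hx hy =>
      rw [hx α, hy (α ∘ x)]; rfl

end final

/-- For the cycle `C_n` (`n ≥ 3`), `k ≥ 1` and a composition `α` of `n`,
the number of `k`-balanced colorings of composition type `α` is unchanged when two adjacent
parts `α_i, α_{i+1}` are swapped; consequently it depends only on the multiset of parts,
i.e. `X^k_{C_n}` is a symmetric function. -/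
theorem stmt8 (n : ℕ) (hn : 3 ≤ n) (k : ℕ) (hk : 1 ≤ k) (ℓ : ℕ) (α : Fin ℓ → ℕ)
    (hpos : ∀ t, 0 < α t) (hsum : ∑ t, α t = n) :
    (∀ (i : ℕ) (h : i + 1 < ℓ),
      cycleCount n k ℓ α =
        cycleCount n k ℓ (α ∘ Equiv.swap ⟨i, Nat.lt_of_succ_lt h⟩ ⟨i + 1, h⟩)) ∧
    (∀ σ : Equiv.Perm (Fin ℓ), cycleCount n k ℓ α = cycleCount n k ℓ (α ∘ σ)) := by
  obtain ⟨m, rfl⟩ : ∃ m, n = m + 3 := ⟨n - 3, by omega⟩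
  exact ⟨fun i h => swap_inv α i h, fun σ => perm_inv σ α⟩
end

section
/- Let G be a finite simple graph and k ≥ 1. Define χ_G^k(λ), for each positive integer λ, to be the number of k-balanced colorings of G using colors from {1, …, λ}. Then there exists a polynomial p with rational coefficients such that χ_G^k(λ) = p(λ) for every positive integer λ. -/
/-- Order-theoretic version of being a `k`-balanced coloring. -/
def QCol {V : Type*} (G : SimpleGraph V) (k : ℕ) {α : Type*} [LinearOrder α] (g : V → α) : Prop :=
  (∀ ⦃i j⦄, G.Adj i j → g i ≠ g j) ∧ KBalancedRel G (fun i j => g i < g j) k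

theorem QCol_comp {V : Type*} (G : SimpleGraph V) (k : ℕ) {α β : Type*} [LinearOrder α]
    [LinearOrder β] (e : α ↪o β) (g : V → α) :
    QCol G k (fun v => e (g v)) ↔ QCol G k g := by
  simp [QCol]

/-- Number of surjective patterns. -/
noncomputable def patCount {V : Type*} (G : SimpleGraph V) (k m : ℕ) : ℕ :=
  Nat.card {g : V → Fin m // Function.Surjective g ∧ QCol G k g}

theorem patCount_eq_zero {V : Type*} [Fintype V] (G : SimpleGraph V) (k m : ℕ)
    (h : Fintype.card V < m) : patCount G k m = 0 := by
  unfold patCount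
  have : IsEmpty {g : V → Fin m // Function.Surjective g ∧ QCol G k g} := by
    refine ⟨fun g => ?_⟩
    have := Fintype.card_le_of_surjective g.1 g.2.1
    simp at this
    omega
  exact Nat.card_of_isEmpty

open Classical in
theorem card_image_eq {V : Type*} [Fintype V] (G : SimpleGraph V) (k : ℕ) (S : Finset ℕ+) :
    Nat.card {κ : V → ℕ+ // QCol G k κ ∧ Finset.univ.image κ = S} = patCount G k S.card := by
  symm
  unfold patCount
  let e := S.orderEmbOfFin rfl
  have he : ∀ x, x ∈ S ↔ ∃ i, e i = x := by
    intro x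
    have := S.range_orderEmbOfFin rfl
    rw [← Finset.mem_coe, ← this]; rfl
  refine Nat.card_eq_of_bijective
    (fun g => ⟨fun v => e (g.1 v), (QCol_comp G k e g.1).2 g.2.2, ?_⟩) ⟨?_, ?_⟩
  · ext x
    rw [he]
    simp only [Finset.mem_image, Finset.mem_univ, true_and]
    constructor
    · rintro ⟨v, rfl⟩; exact ⟨_, rfl⟩
    · rintro ⟨i, rfl⟩
      obtain ⟨v, rfl⟩ := g.2.1 i
      exact ⟨v, rfl⟩
  · intro g g' h
    apply Subtype.ext
    funext v
    exact e.injective (congrFun (congrArg Subtype.val h) v)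
  · rintro ⟨κ, hκ, hS⟩
    have h1 : ∀ v, ∃ i, e i = κ v := fun v => by
      rw [← he, ← hS]; simp
    choose g hg using h1
    have hgκ : (fun v => e (g v)) = κ := funext hg
    refine ⟨⟨g, ?_, ?_⟩, Subtype.ext hgκ⟩
    · intro i
      have : e i ∈ Finset.univ.image κ := by rw [hS, he]; exact ⟨i, rfl⟩
      simp only [Finset.mem_image, Finset.mem_univ, true_and] at this
      obtain ⟨v, hv⟩ := this
      exact ⟨v, e.injective ((hg v).trans hv)⟩
    · rw [← QCol_comp G k e, hgκ]; exact hκ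

open Classical in
theorem kChromCount_eq {V : Type*} [Fintype V] (G : SimpleGraph V) (k lam : ℕ) (hl : 0 < lam) :
    kChromCount G k lam = ∑ m ∈ Finset.range (lam + 1), lam.choose m * patCount G k m := by
  let L : ℕ+ := ⟨lam, hl⟩
  have hc : (Finset.Icc 1 L).card = lam := by
    rw [PNat.card_Icc]; simp [L]
  let F : Finset (V → ℕ+) := (Fintype.piFinset fun _ => Finset.Icc 1 L).filter (QCol G k)
  have hF : ∀ κ, κ ∈ F ↔ QCol G k κ ∧ ∀ v, κ v ≤ L := by
    intro κ; simp [F, and_comm]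
  have h1 : kChromCount G k lam = F.card := by
    unfold kChromCount
    exact Nat.subtype_card F hF
  rw [h1, Finset.card_eq_sum_card_fiberwise (f := fun κ => Finset.univ.image κ)
    (t := (Finset.Icc 1 L).powerset)]
  · have h2 : ∀ S ∈ (Finset.Icc 1 L).powerset,
        (F.filter fun κ => Finset.univ.image κ = S).card = patCount G k S.card := by
      intro S hS
      rw [← card_image_eq]
      symm
      apply Nat.subtype_card
      intro κ
      rw [Finset.mem_filter, hF]
      constructor
      · rintro ⟨⟨h, -⟩, h'⟩; exact ⟨h, h'⟩
      · rintro ⟨h, h'⟩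
        refine ⟨⟨h, fun v => ?_⟩, h'⟩
        have : κ v ∈ S := by rw [← h']; simp
        exact (Finset.mem_Icc.1 (Finset.mem_powerset.1 hS this)).2
    rw [Finset.sum_congr rfl h2, Finset.sum_powerset_apply_card (fun m => patCount G k m), hc]
    simp
  · intro κ hκ
    have := ((hF κ).1 hκ).2
    simp only [Finset.coe_powerset, Set.mem_preimage, Set.mem_powerset_iff, Finset.coe_subset]
    intro x hx
    simp only [Finset.mem_image, Finset.mem_univ, true_and] at hx
    obtain ⟨v, rfl⟩ := hx
    simp [this v]

/-- The `k`-balanced chromatic counting function `χ_G^k` agrees with a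
polynomial with rational coefficients at every positive integer. -/
theorem stmt11 {V : Type*} [Fintype V] (G : SimpleGraph V) (k : ℕ) (hk : 1 ≤ k) :
    ∃ p : Polynomial ℚ, ∀ lam : ℕ, 0 < lam →
      p.eval (lam : ℚ) = kChromCount G k lam := by
  refine ⟨∑ m ∈ Finset.range (Fintype.card V + 1),
    Polynomial.C ((patCount G k m : ℚ) / (m.factorial : ℚ)) * descPochhammer ℚ m, ?_⟩
  intro lam hl
  rw [kChromCount_eq G k lam hl, Polynomial.eval_finsetSum]
  have h1 : ∑ m ∈ Finset.range (lam + 1), lam.choose m * patCount G k m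
      = ∑ m ∈ Finset.range (Fintype.card V + 1), lam.choose m * patCount G k m := by
    rcases le_total lam (Fintype.card V) with h | h
    · apply Finset.sum_subset (Finset.range_mono (by omega))
      intro m _ hm
      rw [Nat.choose_eq_zero_of_lt (by simpa using hm), zero_mul]
    · symm
      apply Finset.sum_subset (Finset.range_mono (by omega))
      intro m _ hm
      rw [patCount_eq_zero G k m (by simpa using hm), mul_zero]
  rw [h1, Nat.cast_sum]
  refine Finset.sum_congr rfl fun m _ => ?_
  rw [Polynomial.eval_mul, Polynomial.eval_C, descPochhammer_eval_eq_descFactorial,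
    Nat.descFactorial_eq_factorial_mul_choose]
  have : (m.factorial : ℚ) ≠ 0 := by positivity
  push_cast
  field_simp
end

section
/- Let G be a finite simple graph, let k > 1, and let p be the polynomial with rational coefficients satisfying p(λ) = χ_G^k(λ) for all positive integers λ. Then p has integer coefficients if and only if G is a forest or G admits no k-balanced coloring. -/
open Classical in
noncomputable def colBox (V : Type*) [Fintype V] (l : ℕ+) : Finset (V → ℕ+) :=
  Fintype.piFinset (fun _ : V => Finset.Icc (1:ℕ+) l)

theorem mem_colBox {V : Type*} [Fintype V] (l : ℕ+) (κ : V → ℕ+) :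
    κ ∈ colBox V l ↔ ∀ v, κ v ≤ l := by
  simp [colBox]

theorem card_colBox {V : Type*} [Fintype V] (l : ℕ+) :
    (colBox V l).card = (l:ℕ) ^ Fintype.card V := by
  simp [colBox]

open Classical in
theorem kChromCount_eq_s13 {V : Type*} [Fintype V] (G : SimpleGraph V) (k : ℕ) (l : ℕ+) :
    kChromCount G k l = ((colBox V l).filter (IsKBalancedColoring G k)).card := by
  unfold kChromCount
  apply Nat.subtype_card
  intro κ
  simp only [Finset.mem_filter, mem_colBox]
  constructor
  · rintro ⟨a, b⟩
    exact ⟨b, fun v => by exact_mod_cast a v⟩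
  · rintro ⟨a, b⟩
    exact ⟨fun v => by exact_mod_cast b v, a⟩

def blow {V : Type*} (κ : V → ℕ+) (m : ℕ) (g : V → Fin m) : V → ℕ+ :=
  fun v => ⟨m * ((κ v : ℕ) - 1) + g v + 1, by omega⟩

theorem blow_lt {V : Type*} (κ : V → ℕ+) (m : ℕ) (g : V → Fin m) {i j : V}
    (h : κ i < κ j) : blow κ m g i < blow κ m g j := by
  rw [← PNat.coe_lt_coe] at h ⊢
  simp only [blow, PNat.mk_coe]
  have h1 := (κ i).pos
  have h2 := (g i).2
  have : m * ((κ i : ℕ) - 1 + 1) ≤ m * ((κ j : ℕ) - 1) := Nat.mul_le_mul_left _ (by omega)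
  rw [mul_add] at this
  omega

theorem blow_le {V : Type*} (κ : V → ℕ+) (m : ℕ) (g : V → Fin m) (L : ℕ+) {i : V}
    (h : κ i ≤ L) : (blow κ m g i : ℕ) ≤ m * L := by
  rw [← PNat.coe_le_coe] at h
  simp only [blow, PNat.mk_coe]
  have h1 := (κ i).pos
  have h2 := (g i).2
  have : m * ((κ i : ℕ) - 1 + 1) ≤ m * L := Nat.mul_le_mul_left _ (by omega)
  rw [mul_add] at this
  omega

theorem blow_inj {V : Type*} (κ : V → ℕ+) (m : ℕ) : Function.Injective (blow κ m) := by
  intro g g' h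
  funext v
  have := congrArg PNat.val (congrFun h v)
  simp only [blow, PNat.mk_coe, PNat.val] at this
  apply Fin.ext
  omega

open Classical in
theorem blow_card {V : Type*} [Fintype V] (κ : V → ℕ+) (m L : ℕ+) (hL : ∀ v, κ v ≤ L)
    (P : (V → ℕ+) → Prop) (hP : ∀ g : V → Fin m, P (blow κ m g)) :
    (m : ℕ) ^ Fintype.card V ≤ ((colBox V (m * L)).filter P).card := by
  have : (m : ℕ) ^ Fintype.card V = (Finset.univ : Finset (V → Fin m)).card := by simp
  rw [this]
  apply Finset.card_le_card_of_injOn (blow κ m)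
  · intro g _
    simp only [Finset.coe_filter, Set.mem_setOf_eq, mem_colBox]
    refine ⟨fun v => ?_, hP g⟩
    rw [← PNat.coe_le_coe, PNat.mul_coe]
    exact blow_le κ m g L (hL v)
  · exact (blow_inj κ m).injOn

theorem exists_bound {V : Type*} [Fintype V] (κ : V → ℕ+) : ∃ L : ℕ+, ∀ v, κ v ≤ L := by
  refine ⟨∏ v, κ v, fun v => ?_⟩
  exact PNat.le_of_dvd (Finset.dvd_prod_of_mem κ (Finset.mem_univ v))

theorem blow_lt_iff {V : Type*} (κ : V → ℕ+) (m : ℕ) (g : V → Fin m) {i j : V}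
    (h : κ i ≠ κ j) : blow κ m g i < blow κ m g j ↔ κ i < κ j := by
  refine ⟨fun h' => ?_, blow_lt κ m g⟩
  by_contra h2
  exact absurd h' (blow_lt κ m g (lt_of_le_of_ne (not_lt.1 h2) h.symm)).not_gt

theorem fwdCount_congr {V : Type*} {G : SimpleGraph V} {v : V} (r s : V → V → Prop)
    (c : G.Walk v v) (h : ∀ i j, G.Adj i j → (r i j ↔ s i j)) : fwdCount r c = fwdCount s c := by
  unfold fwdCount
  congr 1
  apply List.filter_congr
  intro d _
  simp [h _ _ d.adj]

theorem blow_balanced {V : Type*} (G : SimpleGraph V) (k : ℕ) (κ : V → ℕ+)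
    (h : IsKBalancedColoring G k κ) (m : ℕ) (g : V → Fin m) :
    IsKBalancedColoring G k (blow κ m g) := by
  obtain ⟨hp, hb⟩ := h
  constructor
  · intro i j hij he
    rcases lt_or_gt_of_ne (hp hij) with h | h
    · exact (blow_lt κ m g h).ne he
    · exact (blow_lt κ m g h).ne he.symm
  · intro v c hc
    have := hb c hc
    rwa [fwdCount_congr _ (fun i j => κ i < κ j) c (fun i j hij => blow_lt_iff κ m g (hp hij)),
      fwdCount_congr _ (fun i j => κ j < κ i) c
        (fun i j hij => blow_lt_iff κ m g (hp hij).symm)]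

theorem path_col {V : Type*} {G : SimpleGraph V} {u v : V} (q : G.Walk u v) (hq : q.IsPath) :
    ∃ κ : V → ℕ+, ∀ d ∈ q.darts, κ d.toProd.1 < κ d.toProd.2 := by
  classical
  induction q with
  | nil => exact ⟨fun _ => 1, by simp⟩
  | @cons a b c h q ih =>
    rw [SimpleGraph.Walk.cons_isPath_iff] at hq
    obtain ⟨κ, hκ⟩ := ih hq.1
    refine ⟨fun w => if w = a then 1 else κ w + 1, ?_⟩
    intro d hd
    rw [SimpleGraph.Walk.darts_cons, List.mem_cons] at hd
    rcases hd with rfl | hd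
    · simp [h.ne.symm]
    · have h1 : d.toProd.1 ≠ a := fun e => hq.2 (e ▸ q.dart_fst_mem_support_of_mem_darts hd)
      have h2 : d.toProd.2 ≠ a := fun e => hq.2 (e ▸ q.dart_snd_mem_support_of_mem_darts hd)
      simpa [h1, h2] using hκ d hd

theorem exists_bad {V : Type*} (G : SimpleGraph V) (k : ℕ) (hk : 1 < k) (hG : ¬ G.IsAcyclic) :
    ∃ κ : V → ℕ+, ∀ (m : ℕ) (g : V → Fin m), ¬ IsKBalancedColoring G k (blow κ m g) := by
  classical
  unfold SimpleGraph.IsAcyclic at hG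
  push Not at hG
  obtain ⟨v, c, hc⟩ := hG
  cases c with
  | nil => exact absurd hc (by simp)
  | @cons _ u _ h q =>
    have hq := ((SimpleGraph.Walk.cons_isCycle_iff q h).1 hc).1
    obtain ⟨κ, hκ⟩ := path_col q hq
    refine ⟨κ, fun m g hb => ?_⟩
    have h2 := (hb.2 _ hc).2
    unfold fwdCount at h2
    rw [SimpleGraph.Walk.darts_cons] at h2
    rw [List.filter_cons] at h2
    beta_reduce at h2
    rw [List.filter_eq_nil_iff.2 (by
      intro d hd
      simpa using (blow_lt κ m g (hκ d hd)).le)] at h2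
    split_ifs at h2 <;> simp at h2 <;> omega

open Classical in
theorem ker_card {V : Type*} [Fintype V] (s : Setoid V) (l : ℕ+) :
    ((colBox V l).filter (fun κ => Setoid.ker κ = s)).card =
      (l : ℕ).descFactorial (Fintype.card (Quotient s)) := by
  have h1 : (l : ℕ) = Fintype.card (Finset.Icc (1:ℕ+) l) := by simp
  have h2 := Fintype.card_embedding_eq (α := Quotient s) (β := Finset.Icc (1:ℕ+) l)
  rw [← h1] at h2
  rw [← h2, ← Finset.card_univ]
  symm
  refine Finset.card_bij (fun f _ v => (f (Quotient.mk s v) : ℕ+)) ?_ ?_ ?_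
  · intro f _
    simp only [Finset.mem_filter, mem_colBox]
    refine ⟨fun v => (Finset.mem_Icc.1 (f _).2).2, ?_⟩
    ext a b
    rw [Setoid.ker_def]
    constructor
    · intro h
      exact Quotient.exact (f.injective (Subtype.ext h))
    · intro h
      rw [Quotient.sound h]
  · intro f _ f' _ h
    ext q
    induction q using Quotient.inductionOn with
    | h v => exact congrFun h v
  · intro κ hκ
    simp only [Finset.mem_filter, mem_colBox] at hκ
    obtain ⟨ha, rfl⟩ := hκ
    refine ⟨⟨Quotient.lift (fun v => ⟨κ v, by simp [ha v]⟩) ?_, ?_⟩, Finset.mem_univ _, ?_⟩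
    · intro a b h
      exact Subtype.ext h
    · intro x y
      refine Quotient.inductionOn₂ x y ?_
      intro a b h
      exact Quotient.sound (congrArg Subtype.val h : κ a = κ b)
    · rfl

open Classical in
theorem proper_poly {V : Type*} [Fintype V] (G : SimpleGraph V) :
    ∃ Q : Polynomial ℤ, ∀ l : ℕ+,
      Q.eval (l : ℤ) = ((colBox V l).filter (IsProperColoring G)).card := by
  haveI : Fintype (Setoid V) := Fintype.ofInjective (fun s : Setoid V => fun a b => s a b)
    (fun s t h => by ext a b; exact iff_of_eq (congrFun (congrFun h a) b))
  refine ⟨∑ s : Setoid V, if (∀ i j, G.Adj i j → ¬ s i j) then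
    descPochhammer ℤ (Fintype.card (Quotient s)) else 0, fun l => ?_⟩
  rw [Finset.card_eq_sum_card_fiberwise (f := fun κ => Setoid.ker κ) (t := Finset.univ)
    (fun _ _ => by simp), Polynomial.eval_finset_sum, Nat.cast_sum]
  refine Finset.sum_congr rfl fun s _ => ?_
  rw [Finset.filter_filter]
  split_ifs with h
  · rw [descPochhammer_eval_eq_descFactorial, ← ker_card]
    congr 2
    ext κ
    simp only [Finset.mem_filter, and_congr_right_iff]
    intro _
    refine ⟨fun e => ⟨?_, e⟩, fun e => e.2⟩
    subst e
    exact fun i j hij => h i j hij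
  · rw [Polynomial.eval_zero, eq_comm, Nat.cast_eq_zero, Finset.card_eq_zero,
      Finset.filter_eq_empty_iff]
    rintro κ _ ⟨h1, rfl⟩
    exact h fun i j hij => h1 hij

theorem int_of_acyclic {V : Type*} [Fintype V] (G : SimpleGraph V) (k : ℕ)
    (p : Polynomial ℚ)
    (hp : ∀ lam : ℕ, 0 < lam → p.eval (lam : ℚ) = kChromCount G k lam)
    (Q : Polynomial ℤ) (hQ : ∀ l : ℕ+, Q.eval (l : ℤ) = kChromCount G k l) :
    ∀ i : ℕ, ∃ z : ℤ, p.coeff i = (z : ℚ) := by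
  have : p = Q.map (Int.castRingHom ℚ) := by
    apply Polynomial.eq_of_infinite_eval_eq
    apply Set.Infinite.mono (s := Set.range (fun l : ℕ+ => ((l : ℕ) : ℚ)))
    · rintro _ ⟨l, rfl⟩
      simp only [Set.mem_setOf_eq]
      rw [hp l l.pos]
      have := congrArg (Int.cast : ℤ → ℚ) (hQ l)
      have h2 := Polynomial.eval_map_apply (p := Q) (Int.castRingHom ℚ) ((l : ℕ) : ℤ)
      rw [eq_intCast, eq_intCast, Int.cast_natCast] at h2
      rw [h2, this, Int.cast_natCast]
    · apply Set.infinite_range_of_injective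
      intro a b h
      simpa using h
  intro i
  exact ⟨Q.coeff i, by rw [this]; simp⟩

open Filter Topology in
theorem not_int (p : Polynomial ℚ) (n : ℕ) (a b : ℚ) (ha : 0 < a) (hb : b < 1) (u : ℕ → ℚ)
    (hu : Tendsto u atTop atTop)
    (h : ∀ m, a ≤ p.eval (u m) / (u m) ^ n ∧ p.eval (u m) / (u m) ^ n ≤ b) :
    ¬ ∃ z : ℤ, p.coeff n = z := by
  rintro ⟨z, hz⟩
  have hX : ∀ x : ℚ, (Polynomial.X ^ n : Polynomial ℚ).eval x = x ^ n := by simp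
  rcases lt_trichotomy p.degree ((Polynomial.X ^ n : Polynomial ℚ).degree) with hd | hd | hd
  · have := (Polynomial.div_tendsto_zero_of_degree_lt p _ hd).comp hu
    have := ge_of_tendsto' this (b := a) (fun m => by simpa using (h m).1)
    linarith
  · have := (Polynomial.div_tendsto_leadingCoeff_div_of_degree_eq p _ hd).comp hu
    have h1 := ge_of_tendsto' this (b := a) (fun m => by simpa using (h m).1)
    have h2 := le_of_tendsto' this (b := b) (fun m => by simpa using (h m).2)
    have h3 : p.natDegree = n := Polynomial.natDegree_eq_of_degree_eq_some (by simpa using hd)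
    rw [Polynomial.leadingCoeff, h3, hz] at h1 h2
    simp at h1 h2
    have h4 : (0 : ℚ) < z := by linarith
    have h5 : (z : ℚ) < 1 := by linarith
    norm_cast at h4 h5
    omega
  · have := (Polynomial.abs_div_tendsto_atTop_of_degree_gt p _ hd (by simp)).comp hu
    obtain ⟨m, hm⟩ := (this.eventually_gt_atTop b).exists
    simp only [Function.comp, hX] at hm
    rw [abs_of_pos (by linarith [(h m).1])] at hm
    linarith [(h m).2]

/-- For `k > 1`, the polynomial `p` with `p(λ) = χ_G^k(λ)` for all positive
integers `λ` has integer coefficients iff `G` is a forest or `G` admits no `k`-balanced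
coloring. -/
theorem stmt13 {V : Type*} [Fintype V] (G : SimpleGraph V) (k : ℕ) (hk : 1 < k)
    (p : Polynomial ℚ)
    (hp : ∀ lam : ℕ, 0 < lam → p.eval (lam : ℚ) = kChromCount G k lam) :
    (∀ i : ℕ, ∃ z : ℤ, p.coeff i = (z : ℚ)) ↔
      (G.IsAcyclic ∨ ¬ ∃ κ : V → ℕ+, IsKBalancedColoring G k κ) := by
  classical
  constructor
  · intro hint
    by_contra hcon
    push Not at hcon
    obtain ⟨hG, κ, hκ⟩ := hcon
    obtain ⟨κ', hκ'⟩ := exists_bad G k hk hG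
    obtain ⟨L1, hL1⟩ := exists_bound κ
    obtain ⟨L2, hL2⟩ := exists_bound κ'
    set L := max L1 L2 with hLdef
    set n := Fintype.card V
    have hLpos : (0 : ℚ) < (L : ℕ) := by exact_mod_cast L.pos
    refine not_int p n (1 / ((L : ℕ) : ℚ) ^ n) (1 - 1 / ((L : ℕ) : ℚ) ^ n) (by positivity)
      (by linarith [show (0 : ℚ) < 1 / ((L : ℕ) : ℚ) ^ n by positivity])
      (fun m => ((m + 1 : ℕ) : ℚ) * (L : ℕ)) ?_ ?_ (hint n)
    · apply Filter.Tendsto.atTop_mul_const hLpos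
      exact tendsto_natCast_atTop_atTop.comp (Filter.tendsto_add_atTop_nat 1)
    · intro m
      have e := hp ((m.succPNat * L : ℕ+) : ℕ) (PNat.pos _)
      rw [kChromCount_eq_s13] at e
      have g1 := blow_card κ m.succPNat L (fun v => (hL1 v).trans (le_max_left _ _))
        (IsKBalancedColoring G k) (fun g => blow_balanced G k κ hκ _ g)
      have g2 := blow_card κ' m.succPNat L (fun v => (hL2 v).trans (le_max_right _ _))
        (fun κ => ¬ IsKBalancedColoring G k κ) (fun g => hκ' _ g)
      have g3 := Finset.card_filter_add_card_filter_not (s := colBox V (m.succPNat * L))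
        (IsKBalancedColoring G k)
      rw [card_colBox] at g3
      set A := ((colBox V (m.succPNat * L)).filter (IsKBalancedColoring G k)).card
      set B := ((colBox V (m.succPNat * L)).filter
        (fun κ => ¬ IsKBalancedColoring G k κ)).card
      simp only [PNat.mul_coe, Nat.succPNat_coe, Nat.succ_eq_add_one, Nat.cast_mul] at e g1 g2 g3
      simp only [e]
      have q1 : ((m + 1 : ℕ) : ℚ) ^ n ≤ A := by exact_mod_cast g1
      have q2 : ((m + 1 : ℕ) : ℚ) ^ n ≤ B := by
        have g2' : (m + 1) ^ n ≤ B := by convert g2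
        exact_mod_cast g2'
      have q3 : (A : ℚ) + B = (((m + 1 : ℕ) : ℚ) * (L : ℕ)) ^ n := by exact_mod_cast g3
      have hm : (0 : ℚ) < ((m + 1 : ℕ) : ℚ) := by positivity
      have hone : 1 / ((L : ℕ) : ℚ) ^ n =
        ((m + 1 : ℕ) : ℚ) ^ n / (((m + 1 : ℕ) : ℚ) * (L : ℕ)) ^ n := by
        rw [mul_pow]; field_simp
      have hD : (0 : ℚ) < (((m + 1 : ℕ) : ℚ) * (L : ℕ)) ^ n := by positivity
      rw [hone]
      constructor
      · gcongr
      · rw [le_sub_iff_add_le, ← add_div, div_le_one hD]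
        linarith
  · rintro (h | h)
    · obtain ⟨Q, hQ⟩ := proper_poly G
      refine int_of_acyclic G k p hp Q fun l => ?_
      rw [hQ, kChromCount_eq_s13]
      congr 2
      ext κ
      simp only [Finset.mem_filter, and_congr_right_iff]
      intro _
      exact ⟨fun e => ⟨e, fun v c hc => absurd hc (h c)⟩, fun e => e.1⟩
    · refine int_of_acyclic G k p hp 0 fun l => ?_
      rw [kChromCount_eq_s13, Polynomial.eval_zero, eq_comm, Nat.cast_eq_zero, Finset.card_eq_zero,
        Finset.filter_eq_empty_iff]
      exact fun κ _ hκ => h ⟨κ, hκ⟩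
end
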